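/- arXiv:2511.08445 — 4 statements merged into one kernel-verified Lean document; each statement's English description precedes it below -/
import Mathlib

section
/- Let G be a finite group, N a normal subgroup of G, ρ an irreducible unitary representation of G with character χ = Tr ρ, and F : G → ℂ. Then the squared Frobenius (Hilbert–Schmidt) norm of the Fourier coefficient F̂(ρ) = ∑_{g} F(g) ρ(g) satisfies ‖F̂(ρ)‖_{S²}² ≤ (|G| / ∑_{n ∈ N} |χ(n)|²) · ∑_{g₁, g₂ ∈ G, g₁g₂ ∈ N} F(g₁) conj(F(g₂⁻¹)) χ(g₁ g₂). -/
open scoped BigOperators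

open Matrix in
/-- the sesquilinear form -/
noncomputable def BB {G : Type*} [Group G] [Fintype G] (N : Subgroup G) [DecidablePred (· ∈ N)]
    (χ : G → ℂ) (F F' : G → ℂ) : ℂ :=
  ∑ g : G, ∑ h : G, if g * h⁻¹ ∈ N then F g * (starRingEnd ℂ) (F' h) * χ (g * h⁻¹) else 0

section core
open Matrix
variable {G n : Type*} [Group G] [Fintype G] [Fintype n] [DecidableEq n]
  (N : Subgroup G) [N.Normal] [DecidablePred (· ∈ N)]
  (R : G →* Matrix n n ℂ)

theorem BB_sub (χ F1 F2 F' : G → ℂ) (c : ℂ) :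
    BB N χ (fun g => F1 g - c * F2 g) F' = BB N χ F1 F' - c * BB N χ F2 F' := by
  unfold BB
  rw [Finset.mul_sum, ← Finset.sum_sub_distrib]
  refine Finset.sum_congr rfl fun g _ => ?_
  rw [Finset.mul_sum, ← Finset.sum_sub_distrib]
  refine Finset.sum_congr rfl fun h _ => ?_
  split_ifs <;> ring

theorem BB_conj (hU : ∀ g, R g⁻¹ = (R g)ᴴ) (F F' : G → ℂ) :
    (starRingEnd ℂ) (BB N (fun g => (R g).trace) F F') = BB N (fun g => (R g).trace) F' F := by
  unfold BB
  simp only [map_sum]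
  rw [Finset.sum_comm]
  refine Finset.sum_congr rfl fun g _ => Finset.sum_congr rfl fun h _ => ?_
  have e : g * h⁻¹ = (h * g⁻¹)⁻¹ := by group
  have e2 : g * h⁻¹ ∈ N ↔ h * g⁻¹ ∈ N := by rw [e, inv_mem_iff]
  by_cases hN : h * g⁻¹ ∈ N
  · rw [if_pos hN, if_pos (e2.2 hN), e, hU, trace_conjTranspose]
    simp only [map_mul, RCLike.star_def, Complex.conj_conj]
    ring
  · rw [if_neg hN, if_neg (fun h => hN (e2.1 h)), map_zero]

theorem BB_nonneg (hU : ∀ g, R g⁻¹ = (R g)ᴴ) (F : G → ℂ) :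
    0 ≤ (BB N (fun g => (R g).trace) F F).re := by
  classical
  let P : G ⧸ N → n → n → ℂ := fun c i j =>
    ∑ g : G, if (g : G ⧸ N) = c then F g * R g i j else 0
  have : BB N (fun g => (R g).trace) F F
      = ∑ c : G ⧸ N, ∑ i, ∑ j, P c i j * (starRingEnd ℂ) (P c i j) := by
    simp only [P, map_sum, Finset.sum_mul_sum]
    have h1 : ∀ c : G ⧸ N, ∀ g h : G, ∀ i j, (if (g : G ⧸ N) = c then F g * R g i j else 0) *
        (starRingEnd ℂ) (if (h : G ⧸ N) = c then F h * R h i j else 0) =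
        if (g : G ⧸ N) = c then (if (h : G ⧸ N) = c then
          F g * (starRingEnd ℂ) (F h) * (R g i j * (starRingEnd ℂ) (R h i j)) else 0) else 0 := by
      intro c g h i j
      split_ifs <;> simp
      ring
    simp only [h1]
    have h2 : ∀ c : G ⧸ N, ∑ i, ∑ j, ∑ g : G, ∑ h : G,
        (if (g : G ⧸ N) = c then (if (h : G ⧸ N) = c then
          F g * (starRingEnd ℂ) (F h) * (R g i j * (starRingEnd ℂ) (R h i j)) else 0) else 0)
        = ∑ g : G, ∑ h : G, (if (g : G ⧸ N) = c then (if (h : G ⧸ N) = c then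
          F g * (starRingEnd ℂ) (F h) * (R (g * h⁻¹)).trace else 0) else 0) := by
      intro c
      have : ∀ i, ∑ j, ∑ g : G, ∑ h : G,
        (if (g : G ⧸ N) = c then (if (h : G ⧸ N) = c then
          F g * (starRingEnd ℂ) (F h) * (R g i j * (starRingEnd ℂ) (R h i j)) else 0) else 0)
          = ∑ g : G, ∑ h : G, ∑ j, (if (g : G ⧸ N) = c then (if (h : G ⧸ N) = c then
          F g * (starRingEnd ℂ) (F h) * (R g i j * (starRingEnd ℂ) (R h i j)) else 0) else 0) := by
        intro i
        rw [Finset.sum_comm]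
        exact Finset.sum_congr rfl fun g _ => Finset.sum_comm
      simp only [this]
      rw [Finset.sum_comm]
      refine Finset.sum_congr rfl fun g _ => ?_
      rw [Finset.sum_comm]
      refine Finset.sum_congr rfl fun h _ => ?_
      split_ifs
      · rw [map_mul, hU]
        simp only [Matrix.trace, Matrix.diag, Matrix.mul_apply, Matrix.conjTranspose_apply,
          Finset.mul_sum, RCLike.star_def]
      · simp
      · simp
    simp only [h2]
    rw [Finset.sum_comm]
    unfold BB
    refine Finset.sum_congr rfl fun g _ => ?_
    rw [Finset.sum_comm]
    refine Finset.sum_congr rfl fun h _ => ?_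
    rw [Finset.sum_ite_eq]
    have : g * h⁻¹ ∈ N ↔ (h : G ⧸ N) = (g : G ⧸ N) := by
      rw [← QuotientGroup.eq_one_iff, QuotientGroup.mk_mul, QuotientGroup.mk_inv,
        mul_inv_eq_one, eq_comm]
    simp only [this, Finset.mem_univ, if_true]
  rw [this]
  simp only [Complex.re_sum, Complex.mul_conj, Complex.ofReal_re]
  exact Finset.sum_nonneg fun _ _ => Finset.sum_nonneg fun _ _ => Finset.sum_nonneg fun _ _ =>
    Complex.normSq_nonneg _

theorem Phi_eq [Nonempty n] (hU : ∀ g, R g⁻¹ = (R g)ᴴ)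
    (hS : ∀ M, (∀ g, R g * M = M * R g) → ∃ c : ℂ, M = c • 1) :
    (∑ g : G, if g ∈ N then (R g).trace • R g⁻¹ else 0)
      = (((∑ k : N, ‖(R (k : G)).trace‖ ^ 2 : ℝ) : ℂ) / (Fintype.card n : ℂ)) • (1 : Matrix n n ℂ) := by
  obtain ⟨c, hc⟩ := hS (∑ g : G, if g ∈ N then (R g).trace • R g⁻¹ else 0) (by
    intro x
    rw [Finset.mul_sum, Finset.sum_mul]
    refine Fintype.sum_equiv (MulAut.conj x).toEquiv _ _ fun g => ?_
    simp only [MulEquiv.toEquiv_eq_coe, EquivLike.coe_coe, MulAut.conj_apply]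
    have e : x * g * x⁻¹ ∈ N ↔ g ∈ N := by
      constructor
      · intro h
        have := Subgroup.Normal.conj_mem ‹N.Normal› _ h x⁻¹
        simpa [mul_assoc] using this
      · intro h
        exact Subgroup.Normal.conj_mem ‹N.Normal› _ h x
    simp only [e]
    split_ifs
    · have t : (R (x * g * x⁻¹)).trace = (R g).trace := by
        rw [map_mul, Matrix.trace_mul_comm, ← map_mul]; simp
      rw [t, Matrix.mul_smul, Matrix.smul_mul, ← map_mul, ← map_mul]
      congr 2
      group
    · simp)
  have hd : (Fintype.card n : ℂ) ≠ 0 := by simp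
  rw [hc]
  have ht := congrArg Matrix.trace hc
  rw [Matrix.trace_smul, Matrix.trace_one, Matrix.trace_sum] at ht
  have : (∑ g : G, (if g ∈ N then (R g).trace • R g⁻¹ else 0 : Matrix n n ℂ).trace)
      = ((∑ k : N, ‖(R (k : G)).trace‖ ^ 2 : ℝ) : ℂ) := by
    have h1 : ∀ g : G, (if g ∈ N then (R g).trace • R g⁻¹ else 0 : Matrix n n ℂ).trace
        = if g ∈ N then ((‖(R g).trace‖ ^ 2 : ℝ) : ℂ) else 0 := by
      intro g
      split_ifs
      · rw [Matrix.trace_smul, hU, trace_conjTranspose, smul_eq_mul, RCLike.star_def,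
          Complex.mul_conj, Complex.normSq_eq_norm_sq]
      · simp
    simp only [h1]
    rw [← Finset.sum_filter, Complex.ofReal_sum]
    exact Finset.sum_subtype _ (by simp) _
  rw [this] at ht
  rw [ht, smul_eq_mul, mul_div_cancel_right₀ _ hd]

theorem BB_f1 [Nonempty n] (hU : ∀ g, R g⁻¹ = (R g)ᴴ)
    (hS : ∀ M, (∀ g, R g * M = M * R g) → ∃ c : ℂ, M = c • 1)
    (A : Matrix n n ℂ) (F : G → ℂ) :
    BB N (fun g => (R g).trace) (fun g => (A * R g⁻¹).trace) F =
      (((∑ k : N, ‖(R (k : G)).trace‖ ^ 2 : ℝ) : ℂ) / (Fintype.card n : ℂ)) *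
        (A * (∑ g, F g • R g)ᴴ).trace := by
  have h0 := Phi_eq N R hU hS
  set s := (((∑ k : N, ‖(R (k : G)).trace‖ ^ 2 : ℝ) : ℂ) / (Fintype.card n : ℂ))
  unfold BB
  rw [Finset.sum_comm, conjTranspose_sum, Finset.mul_sum, trace_sum, Finset.mul_sum]
  refine Finset.sum_congr rfl fun h _ => ?_
  have key : (A * R h⁻¹ * ∑ g : G, if g ∈ N then (R g).trace • R g⁻¹ else 0).trace
      = s * (A * R h⁻¹).trace := by
    rw [h0, Matrix.mul_smul, Matrix.mul_one, trace_smul, smul_eq_mul]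
  rw [conjTranspose_smul, ← hU, Matrix.mul_smul, trace_smul, smul_eq_mul, RCLike.star_def,
    mul_left_comm, ← key, Finset.mul_sum, trace_sum, Finset.mul_sum]
  refine Fintype.sum_equiv (Equiv.mulRight h⁻¹) _ _ fun g => ?_
  change _ = (starRingEnd ℂ) (F h) * (A * R h⁻¹ * if g * h⁻¹ ∈ N then
    (R (g * h⁻¹)).trace • R (g * h⁻¹)⁻¹ else 0).trace
  by_cases hN : g * h⁻¹ ∈ N
  · rw [if_pos hN, if_pos hN, Matrix.mul_smul, trace_smul, smul_eq_mul, Matrix.mul_assoc, ← map_mul]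
    have : h⁻¹ * (g * h⁻¹)⁻¹ = g⁻¹ := by group
    rw [this]; ring
  · rw [if_neg hN, if_neg hN]; simp

theorem hat_f1 [Nonempty n] (hS : ∀ M, (∀ g, R g * M = M * R g) → ∃ c : ℂ, M = c • 1)
    (A : Matrix n n ℂ) :
    ∑ g, (A * R g⁻¹).trace • R g = ((Fintype.card G : ℂ) / (Fintype.card n : ℂ)) • A := by
  have hd : (Fintype.card n : ℂ) ≠ 0 := by simp
  have schur : ∀ X : Matrix n n ℂ, ∑ g, R g * X * R g⁻¹ =
      ((Fintype.card G : ℂ) / (Fintype.card n : ℂ) * X.trace) • (1 : Matrix n n ℂ) := by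
    intro X
    obtain ⟨c, hc⟩ := hS (∑ g, R g * X * R g⁻¹) (by
      intro x
      rw [Finset.mul_sum, Finset.sum_mul]
      refine Fintype.sum_equiv (Equiv.mulLeft x) _ _ fun g => ?_
      simp only [Equiv.coe_mulLeft, _root_.mul_inv_rev, map_mul, Matrix.mul_assoc]
      rw [← map_mul R x⁻¹ x]
      simp)
    have ht := congrArg Matrix.trace hc
    have h1 : ∀ g, (R g * X * R g⁻¹).trace = X.trace := by
      intro g
      rw [Matrix.trace_mul_comm, ← Matrix.mul_assoc, ← map_mul]; simp
    rw [Matrix.trace_smul, Matrix.trace_one, Matrix.trace_sum] at ht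
    simp only [h1, Finset.sum_const, Finset.card_univ, nsmul_eq_mul, smul_eq_mul] at ht
    rw [hc]
    congr 1
    field_simp
    linear_combination -ht
  ext i j
  have h2 : ∀ k l, ∑ g, R g i j * R g⁻¹ k l =
      (Fintype.card G : ℂ) / (Fintype.card n : ℂ) * (if j = k then 1 else 0) * (if i = l then 1 else 0) := by
    intro k l
    have := congrFun (congrFun (schur (Matrix.single j k 1)) i) l
    rw [Matrix.sum_apply] at this
    have h3 : ∀ g, (R g * Matrix.single j k (1 : ℂ) * R g⁻¹ : Matrix n n ℂ) i l = R g i j * R g⁻¹ k l := by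
      intro g
      rw [Matrix.mul_apply, Finset.sum_eq_single k]
      · simp
      · intro b _ hb
        rw [Matrix.mul_single_apply_of_ne _ _ _ _ _ hb, zero_mul]
      · simp
    simp only [h3] at this
    rw [this, Matrix.smul_apply, Matrix.one_apply, smul_eq_mul]
    congr 2
    by_cases hjk : j = k
    · subst hjk; simp
    · simp [hjk, Matrix.trace_single_eq_of_ne]
  rw [Matrix.sum_apply]
  simp only [Matrix.smul_apply, smul_eq_mul, Matrix.trace, Matrix.diag, Matrix.mul_apply,
    Finset.sum_mul]
  rw [Finset.sum_comm]
  have h4 : ∀ y, ∑ x, ∑ i_1, A y i_1 * R x⁻¹ i_1 y * R x i j =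
      ∑ i_1, A y i_1 * ((Fintype.card G : ℂ) / (Fintype.card n : ℂ) * (if j = i_1 then 1 else 0) * (if i = y then 1 else 0)) := by
    intro y
    rw [Finset.sum_comm]
    refine Finset.sum_congr rfl fun z _ => ?_
    rw [← h2, Finset.mul_sum]
    exact Finset.sum_congr rfl fun g _ => by ring
  simp only [h4]
  simp [mul_comm]

theorem core [Nonempty n] (hU : ∀ g, R g⁻¹ = (R g)ᴴ)
    (hS : ∀ M, (∀ g, R g * M = M * R g) → ∃ c : ℂ, M = c • 1) (F : G → ℂ) :
    ((∑ g, F g • R g) * (∑ g, F g • R g)ᴴ).trace.re ≤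
      ((Fintype.card G : ℝ) / ∑ k : N, ‖(R (k : G)).trace‖ ^ 2) *
        (BB N (fun g => (R g).trace) F F).re := by
  set A := ∑ g, F g • R g with hA
  set S : ℝ := ∑ k : N, ‖(R (k : G)).trace‖ ^ 2 with hSdef
  have hd : (Fintype.card n : ℂ) ≠ 0 := by simp
  have hG : (Fintype.card G : ℂ) ≠ 0 := by simp
  have hSpos : 0 < S := by
    refine Finset.sum_pos' (fun _ _ => by positivity) ⟨1, Finset.mem_univ _, ?_⟩
    have : 0 < Fintype.card n := Fintype.card_pos
    simp
    positivity
  set c : ℂ := (Fintype.card n : ℂ) / (Fintype.card G : ℂ) with hc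
  set f : G → ℂ := fun g => (A * R g⁻¹).trace
  set D : G → ℂ := fun g => F g - c * f g with hD
  have hDhat : ∑ g, D g • R g = 0 := by
    simp only [hD, sub_smul, Finset.sum_sub_distrib, mul_smul, ← Finset.smul_sum]
    rw [hat_f1 R hS A, smul_smul, hc, ← hA]
    rw [show (Fintype.card n : ℂ) / (Fintype.card G : ℂ) * ((Fintype.card G : ℂ) / (Fintype.card n : ℂ)) = 1 by field_simp]
    simp
  have h1 : BB N (fun g => (R g).trace) f D = 0 := by
    rw [BB_f1 N R hU hS A D, hDhat]; simp
  have h2 : BB N (fun g => (R g).trace) f F = (S : ℂ) / (Fintype.card n : ℂ) * (A * Aᴴ).trace :=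
    BB_f1 N R hU hS A F
  have h3 : BB N (fun g => (R g).trace) D D = BB N (fun g => (R g).trace) F D := by
    have := BB_sub N (fun g => (R g).trace) F f D c
    rw [h1] at this
    simpa using this
  have h4 : BB N (fun g => (R g).trace) D F = BB N (fun g => (R g).trace) F F
      - ((S / Fintype.card G : ℝ) : ℂ) * (A * Aᴴ).trace := by
    have := BB_sub N (fun g => (R g).trace) F f F c
    rw [h2] at this
    rw [hD, this, hc]
    push_cast
    field_simp
  have h5 := BB_nonneg N R hU D
  rw [h3, ← BB_conj N R hU, Complex.conj_re, h4, Complex.sub_re, Complex.re_ofReal_mul] at h5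
  have hG' : (0 : ℝ) < Fintype.card G := by exact_mod_cast Fintype.card_pos
  rw [div_mul_eq_mul_div, le_div_iff₀ hSpos]
  have h6 : S / Fintype.card G * (A * Aᴴ).trace.re ≤ (BB N (fun g => (R g).trace) F F).re := by linarith
  rw [div_mul_eq_mul_div, div_le_iff₀ hG'] at h6
  linarith
end core

/-- **non-abelian amplification, `q = 2`.** For a finite group `G`,
a normal subgroup `N`, an irreducible unitary representation `ρ` with character `χ`,
and `F : G → ℂ`, the squared Frobenius norm of `F̂(ρ) = ∑_g F(g) ρ(g)` satisfies
`‖F̂(ρ)‖_{S²}² ≤ (|G| / ∑_{n ∈ N} |χ(n)|²) ∑_{g₁g₂ ∈ N} F(g₁) conj(F(g₂⁻¹)) χ(g₁g₂)`. -/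
theorem stmt3 {G V : Type*} [Group G] [Fintype G]
    [NormedAddCommGroup V] [InnerProductSpace ℂ V] [FiniteDimensional ℂ V]
    [Nontrivial V]
    (N : Subgroup G) [N.Normal] [DecidablePred (· ∈ N)]
    (ρ : G →* (V →L[ℂ] V)) (hunit : ∀ g v, ‖ρ g v‖ = ‖v‖)
    (hirr : ∀ U : Submodule ℂ V, (∀ g, ∀ v ∈ U, ρ g v ∈ U) → U = ⊥ ∨ U = ⊤)
    (χ : G → ℂ) (hχ : ∀ g, χ g = LinearMap.trace ℂ V ((ρ g) : V →ₗ[ℂ] V))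
    (F : G → ℂ) :
    (LinearMap.trace ℂ V
        (((∑ g : G, F g • ρ g) ∘L
          ContinuousLinearMap.adjoint (∑ g : G, F g • ρ g)) : V →ₗ[ℂ] V)).re ≤
      ((Fintype.card G : ℝ) / ∑ n : N, ‖χ (n : G)‖ ^ 2) *
        (∑ g₁ : G, ∑ g₂ : G,
          if g₁ * g₂ ∈ N then F g₁ * (starRingEnd ℂ) (F g₂⁻¹) * χ (g₁ * g₂) else 0).re := by
  classical
  let b := stdOrthonormalBasis ℂ V
  let T := LinearMap.toMatrixOrthonormal b
  have hne : Nonempty (Fin (Module.finrank ℂ V)) := ⟨⟨0, Module.finrank_pos⟩⟩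
  have htr : ∀ f : V →ₗ[ℂ] V, LinearMap.trace ℂ V f = (T f).trace := fun f =>
    LinearMap.trace_eq_matrix_trace ℂ b.toBasis f
  let R : G →* Matrix (Fin (Module.finrank ℂ V)) (Fin (Module.finrank ℂ V)) ℂ :=
    { toFun := fun g => T (ρ g : V →ₗ[ℂ] V)
      map_one' := by
        rw [map_one]; exact map_one T
      map_mul' := fun x y => by
        rw [map_mul]; exact map_mul T _ _ }
  have hadj : ∀ f : V →L[ℂ] V,
      T ((ContinuousLinearMap.adjoint f : V →L[ℂ] V) : V →ₗ[ℂ] V) = (T (f : V →ₗ[ℂ] V)).conjTranspose := by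
    intro f
    have : ((ContinuousLinearMap.adjoint f : V →L[ℂ] V) : V →ₗ[ℂ] V) = star (f : V →ₗ[ℂ] V) := by
      rfl
    rw [this, map_star]
    rfl
  have hU : ∀ g, R g⁻¹ = (R g).conjTranspose := by
    intro g
    change T (ρ g⁻¹ : V →ₗ[ℂ] V) = (T (ρ g : V →ₗ[ℂ] V)).conjTranspose
    rw [← hadj]
    congr 2
    have h1 : ContinuousLinearMap.adjoint (ρ g) * ρ g = 1 :=
      (ContinuousLinearMap.norm_map_iff_adjoint_comp_self (ρ g)).1 (hunit g)
    have h2 : ρ g * ρ g⁻¹ = 1 := by rw [← map_mul]; simp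
    exact (left_inv_eq_right_inv h1 h2).symm
  have hS : ∀ M, (∀ g, R g * M = M * R g) → ∃ c : ℂ, M = c • 1 := by
    intro M hM
    let m : V →ₗ[ℂ] V := T.symm M
    have hTm : T m = M := T.apply_symm_apply M
    have hcomm : ∀ g, (ρ g : V →ₗ[ℂ] V) * m = m * (ρ g : V →ₗ[ℂ] V) := by
      intro g
      apply T.injective
      change T _ = T _
      rw [map_mul, map_mul, hTm]
      exact hM g
    obtain ⟨c, hc⟩ := Module.End.exists_eigenvalue m
    refine ⟨c, ?_⟩
    rcases hirr (Module.End.eigenspace m c) (by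
      intro g v hv
      rw [Module.End.mem_eigenspace_iff] at hv ⊢
      have := LinearMap.congr_fun (hcomm g) v
      simp only [Module.End.mul_apply, ContinuousLinearMap.coe_coe] at this
      rw [← this, hv, map_smul]) with h | h
    · exact absurd h hc
    · have : m = c • 1 := by
        ext v
        have hv : v ∈ Module.End.eigenspace m c := by rw [h]; trivial
        rw [Module.End.mem_eigenspace_iff] at hv
        simpa using hv
      rw [← hTm, this, map_smul, map_one]
  have key := core N R hU hS F
  have hχ' : χ = fun g => (R g).trace := by
    funext g
    rw [hχ, htr]; rfl
  have hA : T ((∑ g : G, F g • ρ g : V →L[ℂ] V) : V →ₗ[ℂ] V) = ∑ g, F g • R g := by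
    have : ((∑ g : G, F g • ρ g : V →L[ℂ] V) : V →ₗ[ℂ] V) = ∑ g, F g • (ρ g : V →ₗ[ℂ] V) := by
      ext v; simp
    rw [this, map_sum]
    refine Finset.sum_congr rfl fun g _ => ?_
    rw [map_smul]; rfl
  have hL : LinearMap.trace ℂ V
        (((∑ g : G, F g • ρ g) ∘L
          ContinuousLinearMap.adjoint (∑ g : G, F g • ρ g)) : V →ₗ[ℂ] V) =
      ((∑ g, F g • R g) * (∑ g, F g • R g).conjTranspose).trace := by
    rw [htr, ← hA, ← hadj, ← map_mul]
    rfl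
  have hB : (∑ g₁ : G, ∑ g₂ : G,
          if g₁ * g₂ ∈ N then F g₁ * (starRingEnd ℂ) (F g₂⁻¹) * χ (g₁ * g₂) else 0)
      = BB N χ F F := by
    unfold BB
    refine Finset.sum_congr rfl fun g _ => ?_
    refine Fintype.sum_equiv (Equiv.inv G) _ _ fun h => ?_
    simp
  rw [hL, hB, hχ']
  exact key
end

section
/- Let c be a positive integer, a₁, a₂ units modulo c, and 1 ≤ H₁ ≤ H₂ ≤ C·c for a constant C. The number of integer solutions (h₁, h₂, h₃, h₄) with |h₁|, |h₃| ≤ H₁ and |h₂|, |h₄| ≤ H₂ to T^{a₁h₁} S T^{a₂h₂} S T^{a₁h₃} S T^{a₂h₄} S = I in PSL₂(ℤ/cℤ) is O_ε(c^ε (H₂ + H₁H₂/c)) for every ε > 0; in particular it is O_ε(c^ε H₂). -/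
open Matrix

/-- The matrix `T = (1 1; 0 1)` in `SL₂(ℤ/cℤ)`. -/
def Tm (c : ℕ) : SpecialLinearGroup (Fin 2) (ZMod c) :=
  ⟨!![1, 1; 0, 1], by norm_num [Matrix.det_fin_two_of]⟩

/-- The matrix `S = (0 -1; 1 0)` in `SL₂(ℤ/cℤ)`. -/
def Sm (c : ℕ) : SpecialLinearGroup (Fin 2) (ZMod c) :=
  ⟨!![0, -1; 1, 0], by norm_num [Matrix.det_fin_two_of]⟩


lemma divisor_bound (δ : ℝ) (hδ : 0 < δ) :
    ∃ K : ℝ, 1 ≤ K ∧ ∀ n : ℕ, n ≠ 0 → (n.divisors.card : ℝ) ≤ K * (n : ℝ) ^ δ := by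
  have hl : 0 < Real.log 2 := Real.log_pos one_lt_two
  set A : ℝ := 1 + 1 / (δ * Real.log 2) with hA
  have hA1 : 1 ≤ A := by rw [hA]; have : 0 < 1 / (δ * Real.log 2) := by positivity
                         linarith
  set B : ℕ := ⌈(2 : ℝ) ^ (1 / δ)⌉₊ with hB
  refine ⟨A ^ B, one_le_pow₀ hA1, fun n hn => ?_⟩
  rw [Nat.card_divisors hn]
  have hn' : (n : ℝ) ^ δ = ∏ p ∈ n.primeFactors, ((p : ℝ) ^ δ) ^ (n.factorization p) := by
    conv_lhs => rw [← Nat.prod_factorization_pow_eq_self hn]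
    rw [Finsupp.prod, Nat.support_factorization]
    push_cast
    rw [← Real.finsetProd_rpow _ _ (fun i _ => by positivity)]
    refine Finset.prod_congr rfl fun p _ => ?_
    rw [← Real.rpow_natCast, ← Real.rpow_natCast, ← Real.rpow_mul (by positivity),
      ← Real.rpow_mul (by positivity), mul_comm]
  have key : ∀ p ∈ n.primeFactors, ((n.factorization p + 1 : ℕ) : ℝ) ≤
      (if p < B then A else 1) * ((p : ℝ) ^ δ) ^ (n.factorization p) := by
    intro p hp
    have hp2 : (2 : ℝ) ≤ p := by exact_mod_cast (Nat.prime_of_mem_primeFactors hp).two_le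
    set k := n.factorization p
    split_ifs with h
    · have h1 : (2 : ℝ) ^ δ ≤ (p : ℝ) ^ δ := Real.rpow_le_rpow (by norm_num) hp2 hδ.le
      have h2 : 1 + δ * Real.log 2 ≤ (2 : ℝ) ^ δ := by
        rw [Real.rpow_def_of_pos two_pos]
        have := Real.add_one_le_exp (Real.log 2 * δ)
        linarith
      have h3 : 1 + (k : ℝ) * (δ * Real.log 2) ≤ (1 + δ * Real.log 2) ^ k :=
        one_add_mul_le_pow (by have : 0 < δ * Real.log 2 := by positivity
                               linarith) k
      have h4 : (1 + δ * Real.log 2) ^ k ≤ ((p : ℝ) ^ δ) ^ k :=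
        pow_le_pow_left₀ (by positivity) (h2.trans h1) k
      calc ((k + 1 : ℕ) : ℝ) ≤ A * (1 + (k : ℝ) * (δ * Real.log 2)) := by
            have : A * (1 + (k : ℝ) * (δ * Real.log 2)) = 
              1 + k + 1 / (δ * Real.log 2) + (k : ℝ) * (δ * Real.log 2) := by
              rw [hA]; field_simp
              ring
            rw [this]; push_cast
            have : 0 ≤ 1 / (δ * Real.log 2) + (k : ℝ) * (δ * Real.log 2) := by positivity
            linarith
        _ ≤ _ := mul_le_mul_of_nonneg_left (h3.trans h4) (by linarith)
    · rw [one_mul]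
      have h1 : (2 : ℝ) ≤ (p : ℝ) ^ δ := by
        have h2 : (2 : ℝ) ^ (1 / δ) ≤ p := (Nat.le_ceil _).trans (by exact_mod_cast not_lt.mp h)
        calc (2 : ℝ) = ((2 : ℝ) ^ (1 / δ)) ^ δ := by
              rw [← Real.rpow_mul (by norm_num)]; field_simp; simp
          _ ≤ _ := Real.rpow_le_rpow (by positivity) h2 hδ.le
      calc ((k + 1 : ℕ) : ℝ) ≤ (2 : ℝ) ^ k := by exact_mod_cast Nat.lt_two_pow_self
        _ ≤ _ := pow_le_pow_left₀ (by norm_num) h1 k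
  push_cast
  calc ∏ p ∈ n.primeFactors, ((n.factorization p : ℝ) + 1)
      ≤ ∏ p ∈ n.primeFactors, ((if p < B then A else 1) * ((p : ℝ) ^ δ) ^ (n.factorization p)) :=
        Finset.prod_le_prod (fun i _ => by positivity) (fun p hp => by simpa using key p hp)
    _ = (∏ p ∈ n.primeFactors, (if p < B then A else 1)) * (n : ℝ) ^ δ := by
        rw [Finset.prod_mul_distrib, hn']
    _ ≤ A ^ B * (n : ℝ) ^ δ := by
        refine mul_le_mul_of_nonneg_right ?_ (by positivity)
        rw [← Finset.prod_filter, Finset.prod_const]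
        refine pow_le_pow_right₀ hA1 ?_
        calc _ ≤ (Finset.range B).card := Finset.card_le_card (fun x hx => by
                simp at hx ⊢; exact hx.2)
          _ = B := by simp

lemma card_class (c : ℕ) (hc : 0 < c) (N : ℝ) (hN : 0 ≤ N) (s : Finset ℤ)
    (hs : ∀ k ∈ s, |(k : ℝ)| ≤ N) (hd : ∀ k ∈ s, ∀ l ∈ s, (c : ℤ) ∣ k - l) :
    (s.card : ℝ) ≤ 2 * N / c + 1 := by
  have hc' : (0 : ℝ) < c := by exact_mod_cast hc
  rcases s.eq_empty_or_nonempty with rfl | hne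
  · simp; positivity
  obtain ⟨k0, hk0, hmin⟩ := s.exists_min_image id hne
  have : s.card ≤ (Finset.range (⌊2 * N / c⌋₊ + 1)).card := by
    refine Finset.card_le_card_of_injOn (fun k => ((k - k0) / c).toNat) ?_ ?_
    · intro k hk
      have hk : k ∈ s := hk
      simp only [Finset.coe_range, Set.mem_Iio, Nat.lt_succ_iff]
      obtain ⟨q, hq⟩ := hd k hk k0 hk0
      rw [hq, Int.mul_ediv_cancel_left _ (by positivity)]
      have hge : k0 ≤ k := hmin k hk
      have hq0 : 0 ≤ q := by
        by_contra h
        have : (c : ℤ) * q < 0 := mul_neg_of_pos_of_neg (by exact_mod_cast hc) (by lia)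
        lia
      refine Nat.le_floor ?_
      rw [le_div_iff₀ hc']
      have e : ((q.toNat : ℕ) : ℝ) = (q : ℝ) := by
        have := Int.toNat_of_nonneg hq0
        exact_mod_cast congrArg (Int.cast : ℤ → ℝ) this
      rw [e]
      have hq' : (k : ℝ) - k0 = c * q := by exact_mod_cast congrArg (Int.cast : ℤ → ℝ) hq
      have h1 := abs_le.mp (hs k hk)
      have h2 := abs_le.mp (hs k0 hk0)
      linarith
    · intro k hk l hl hkl
      have hk : k ∈ s := hk
      have hl : l ∈ s := hl
      obtain ⟨q, hq⟩ := hd k hk k0 hk0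
      obtain ⟨r, hr⟩ := hd l hl k0 hk0
      have h1 : k0 ≤ k := hmin k hk
      have h2 : k0 ≤ l := hmin l hl
      simp only at hkl
      have e1 := Int.toNat_of_nonneg (Int.ediv_nonneg (by lia : 0 ≤ k - k0) (Int.natCast_nonneg c))
      have e2 := Int.toNat_of_nonneg (Int.ediv_nonneg (by lia : 0 ≤ l - k0) (Int.natCast_nonneg c))
      rw [hkl, e2, hq, hr, Int.mul_ediv_cancel_left _ (by positivity),
        Int.mul_ediv_cancel_left _ (by positivity)] at e1
      subst e1; lia
  rw [Finset.card_range] at this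
  calc (s.card : ℝ) ≤ ((⌊2 * N / c⌋₊ + 1 : ℕ) : ℝ) := by exact_mod_cast this
    _ ≤ _ := by push_cast; have := Nat.floor_le (show 0 ≤ 2 * N / c by positivity); linarith

/-- Integers `n` with `an(an-2) = 0` mod `c` -/
lemma card_values (c : ℕ) (hc : 0 < c) (a : ℤ) (ha : IsCoprime a (c : ℤ)) (N : ℝ) (hN : 0 ≤ N)
    (s : Finset ℤ) (hs : ∀ k ∈ s, |(k : ℝ)| ≤ N)
    (hd : ∀ k ∈ s, (c : ℤ) ∣ (a * k) * (a * k - 2)) :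
    (s.card : ℝ) ≤ (4 * N / c + 1) * c.divisors.card := by
  classical
  have h1 := Finset.card_eq_sum_card_fiberwise (s := s) (t := c.divisors)
    (f := fun k : ℤ => Int.gcd k c) (by
      intro k _
      simp only [Finset.mem_coe, Nat.mem_divisors]
      exact ⟨by exact_mod_cast Int.gcd_dvd_right k (c : ℤ), hc.ne'⟩)
  rw [h1]; push_cast
  calc _ ≤ ∑ _d ∈ c.divisors, (4 * N / c + 1) := by
        refine Finset.sum_le_sum fun d hdc => ?_
        have hinj : Function.Injective (fun k : ℤ => 2 * k) := fun x y h => by simpa using h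
        rw [← Finset.card_image_of_injective _ hinj]
        have := card_class c hc (2 * N) (by positivity)
          ((s.filter (fun k : ℤ => Int.gcd k c = d)).image (fun k : ℤ => 2 * k)) ?_ ?_
        · calc _ ≤ _ := this
            _ = _ := by ring
        · intro k hk
          simp only [Finset.mem_image, Finset.mem_filter] at hk
          obtain ⟨k, ⟨hk, _⟩, rfl⟩ := hk
          have := hs k hk
          push_cast
          rw [abs_mul]; simpa using this
        · intro k hk l hl
          simp only [Finset.mem_image, Finset.mem_filter] at hk hl
          obtain ⟨k, ⟨hk, hgk⟩, rfl⟩ := hk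
          obtain ⟨l, ⟨hl, hgl⟩, rfl⟩ := hl
          obtain ⟨e, he⟩ := (Nat.mem_divisors.mp hdc).1
          have hd0 : 0 < d := Nat.pos_of_mem_divisors hdc
          have main : ∀ m ∈ s, Int.gcd m c = d → (d : ℤ) ∣ m ∧ (e : ℤ) ∣ a * m - 2 := by
            intro m hm hg
            have hdm : (d : ℤ) ∣ m := by rw [← hg]; exact Int.gcd_dvd_left m c
            refine ⟨hdm, ?_⟩
            obtain ⟨q, rfl⟩ := hdm
            have h2 := hd _ hm
            rw [he] at h2 hg
            push_cast at h2 hg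
            have h3 : (e : ℤ) ∣ (a * q) * (a * (d * q) - 2) := by
              have : (d : ℤ) * e ∣ d * ((a * q) * (a * (d * q) - 2)) := by
                convert h2 using 1; ring
              exact Int.dvd_of_mul_dvd_mul_left (by positivity) this
            have h4 : IsCoprime (e : ℤ) (a * q) := by
              refine IsCoprime.mul_right ?_ ?_
              · refine (ha.of_isCoprime_of_dvd_right ?_).symm
                rw [he]; push_cast; exact dvd_mul_left _ _
              · rw [Int.isCoprime_iff_gcd_eq_one]
                rw [Int.gcd_mul_left] at hg
                simp only [Int.natAbs_natCast] at hg
                rw [Int.gcd_comm]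
                exact Nat.eq_of_mul_eq_mul_left hd0 (by rw [hg, mul_one])
            exact h4.dvd_of_dvd_mul_left h3
          obtain ⟨p1, p2⟩ := main k hk hgk
          obtain ⟨q1, q2⟩ := main l hl hgl
          have ce : IsCoprime (e : ℤ) a := by
            refine (ha.of_isCoprime_of_dvd_right ?_).symm
            rw [he]; push_cast; exact dvd_mul_left _ _
          have hek : (e : ℤ) ∣ k - l := by
            refine ce.dvd_of_dvd_mul_left ?_
            have := dvd_sub p2 q2
            convert this using 1; ring
          obtain ⟨u, hu⟩ := dvd_sub p1 q1
          obtain ⟨v, hv⟩ := hek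
          obtain ⟨w, hw⟩ := p1
          obtain ⟨t, ht⟩ := p2
          refine ⟨a * w * v - t * u, ?_⟩
          rw [he]; push_cast
          have : 2 * k - 2 * l = (a * k - (a * k - 2)) * (k - l) := by ring
          rw [this, sub_mul, ht]
          nth_rewrite 1 [hv]
          rw [hu, hw]
          ring
    _ = _ := by rw [Finset.sum_const, nsmul_eq_mul]; ring

lemma card_prod_fiber (n : ℤ) (hn : n ≠ 0) (s : Finset (ℤ × ℤ)) (hs : ∀ p ∈ s, p.1 * p.2 = n) :
    s.card ≤ 2 * n.natAbs.divisors.card := by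
  classical
  calc s.card ≤ (n.natAbs.divisors ×ˢ ({1, -1} : Finset ℤ)).card := by
        refine Finset.card_le_card_of_injOn (fun p => (p.1.natAbs, p.1.sign)) ?_ ?_
        · intro p hp
          have h := hs p hp
          have h0 : p.1 ≠ 0 := by rintro h0; rw [h0, zero_mul] at h; exact hn h.symm
          simp only [Finset.coe_product, Set.mem_prod, Finset.mem_coe, Nat.mem_divisors,
            Finset.mem_insert, Finset.mem_singleton]
          refine ⟨⟨Int.natAbs_dvd_natAbs.mpr ⟨p.2, h.symm⟩, by simpa using hn⟩, ?_⟩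
          rcases lt_or_gt_of_ne h0 with h0 | h0
          · right; exact Int.sign_eq_neg_one_of_neg h0
          · left; exact Int.sign_eq_one_of_pos h0
        · intro p hp q hq h
          have h1 := hs p hp
          have h2 := hs q hq
          simp only [Prod.mk.injEq] at h
          have e : p.1 = q.1 := by
            rw [← Int.sign_mul_natAbs p.1, ← Int.sign_mul_natAbs q.1, h.1, h.2]
          have h0 : p.1 ≠ 0 := by rintro h0; rw [h0, zero_mul] at h1; exact hn h1.symm
          refine Prod.ext e ?_
          rw [← h2, ← e] at h1
          exact mul_left_cancel₀ h0 h1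
    _ = _ := by rw [Finset.card_product]; simp [mul_comm]

lemma zmod_dvd_iff {c : ℕ} {k : ℤ} : ((k : ℤ) : ZMod c) = 0 ↔ (c : ℤ) ∣ k :=
  CharP.intCast_eq_zero_iff (ZMod c) c k

lemma SL_val_mul {c : ℕ} (A B : SpecialLinearGroup (Fin 2) (ZMod c)) :
    (A * B).1 = A.1 * B.1 := Matrix.SpecialLinearGroup.coe_mul A B

lemma SL_val_inv {c : ℕ} (A : SpecialLinearGroup (Fin 2) (ZMod c)) :
    (A⁻¹).1 = A.1.adjugate := Matrix.SpecialLinearGroup.coe_inv A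

lemma Tm_zpow (c : ℕ) (k : ℤ) :
    ((Tm c) ^ k).1 = !![1, (k : ZMod c); 0, 1] := by
  induction k using Int.induction_on with
  | zero => ext i j; fin_cases i <;> fin_cases j <;> simp
  | succ n ih =>
    rw [_root_.zpow_add_one, SL_val_mul, ih]
    ext i j; fin_cases i <;> fin_cases j <;> simp [Tm, Matrix.mul_apply, Fin.sum_univ_two, add_comm]
  | pred n ih =>
    rw [_root_.zpow_sub_one, SL_val_mul, ih, SL_val_inv]
    ext i j; fin_cases i <;> fin_cases j <;>
      simp [Tm, Matrix.mul_apply, Fin.sum_univ_two, Matrix.adjugate_fin_two, sub_eq_add_neg, add_comm]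

lemma eqn_extract (c : ℕ) (k₁ k₂ k₃ k₄ : ℤ) (γ : ZMod c) (hγ : γ ^ 2 = 1)
    (h : ((Tm c) ^ k₁ * Sm c * (Tm c) ^ k₂ * Sm c * (Tm c) ^ k₃ * Sm c * (Tm c) ^ k₄ * Sm c).1
      = γ • (1 : Matrix (Fin 2) (Fin 2) (ZMod c))) :
    (k₁ * k₂ : ZMod c) * (k₁ * k₂ - 2) = 0 ∧ (k₃ : ZMod c) = -(1 - k₁ * k₂) * k₁ ∧
      (k₄ : ZMod c) = -(1 - k₁ * k₂) * k₂ := by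
  simp only [SL_val_mul, Tm_zpow] at h
  have e00 := congrFun (congrFun h 0) 0
  have e01 := congrFun (congrFun h 0) 1
  have e10 := congrFun (congrFun h 1) 0
  have e11 := congrFun (congrFun h 1) 1
  simp [Sm, Matrix.mul_apply, Fin.sum_univ_two] at e00 e01 e10 e11
  generalize (k₁ : ZMod c) = x at *
  generalize (k₂ : ZMod c) = y at *
  generalize (k₃ : ZMod c) = z at *
  generalize (k₄ : ZMod c) = w at *
  have g : γ = 1 - x * y := by linear_combination -e00 - w * e01
  have hx : -x = γ * z := by linear_combination z * e00 + (z * w - 1) * e01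
  have hy : y = -γ * w := by linear_combination -e10 - w * e11
  refine ⟨?_, ?_, ?_⟩
  · rw [g] at hγ; linear_combination hγ
  · rw [← g]; linear_combination (-z) * hγ - γ * hx
  · rw [← g]; linear_combination (-w) * hγ + γ * hy

lemma abs_le_mem_Icc {H : ℝ} {k : ℤ} (h : |(k : ℝ)| ≤ H) : k ∈ Finset.Icc (-⌊H⌋) ⌊H⌋ := by
  have := abs_le.mp h
  rw [Finset.mem_Icc]
  refine ⟨?_, Int.le_floor.mpr this.2⟩
  have : -k ≤ ⌊H⌋ := Int.le_floor.mpr (by push_cast; linarith)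
  lia

lemma card_box {H : ℝ} (hH : 1 ≤ H) : ((Finset.Icc (-⌊H⌋) ⌊H⌋).card : ℝ) ≤ 3 * H := by
  have h0 : 0 ≤ ⌊H⌋ := Int.floor_nonneg.mpr (by linarith)
  have := Int.toNat_of_nonneg (by lia : 0 ≤ ⌊H⌋ + 1 - -⌊H⌋)
  rw [Int.card_Icc]
  have e : (((⌊H⌋ + 1 - -⌊H⌋).toNat : ℕ) : ℝ) = ⌊H⌋ + 1 - -⌊H⌋ := by
    exact_mod_cast congrArg (Int.cast : ℤ → ℝ) this
  rw [e]
  have := Int.floor_le H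
  linarith

/-- Pairs bound. -/
lemma card_pairs (c : ℕ) (hc : 0 < c) (a : ℤ) (ha : IsCoprime a (c : ℤ)) (H₁ H₂ D : ℝ)
    (h1 : 1 ≤ H₁) (h12 : H₁ ≤ H₂)
    (hD : ∀ n : ℕ, n ≠ 0 → (n : ℝ) ≤ H₁ * H₂ → (n.divisors.card : ℝ) ≤ D)
    (s : Finset (ℤ × ℤ)) (hs1 : ∀ p ∈ s, |(p.1 : ℝ)| ≤ H₁) (hs2 : ∀ p ∈ s, |(p.2 : ℝ)| ≤ H₂)
    (hd : ∀ p ∈ s, (c : ℤ) ∣ (a * (p.1 * p.2)) * (a * (p.1 * p.2) - 2)) :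
    (s.card : ℝ) ≤ 6 * H₂ + 2 * D * ((4 * (H₁ * H₂) / c + 1) * c.divisors.card) := by
  classical
  have hH : 0 ≤ H₁ * H₂ := by nlinarith
  have hD0 : 0 ≤ D := le_trans (Nat.cast_nonneg _) (hD 1 one_ne_zero (by push_cast; nlinarith))
  set s' := s.filter (fun p => p.1 * p.2 ≠ 0) with hs'
  set s0 := s.filter (fun p => ¬ (p.1 * p.2 ≠ 0)) with hs0
  have hsum : s'.card + s0.card = s.card := Finset.card_filter_add_card_filter_not _
  have hb0 : (s0.card : ℝ) ≤ 6 * H₂ := by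
    have hsub : s0 ⊆ (Finset.Icc (-⌊H₂⌋) ⌊H₂⌋).image (fun k => ((0 : ℤ), k)) ∪
        (Finset.Icc (-⌊H₁⌋) ⌊H₁⌋).image (fun k => (k, (0 : ℤ))) := by
      rintro ⟨x, y⟩ hp
      simp only [hs0, Finset.mem_filter, not_not, mul_eq_zero] at hp
      obtain ⟨hp, h⟩ := hp
      rw [Finset.mem_union, Finset.mem_image, Finset.mem_image]
      rcases h with h | h
      · left; exact ⟨y, abs_le_mem_Icc (hs2 _ hp), by rw [h]⟩
      · right; exact ⟨x, abs_le_mem_Icc (hs1 _ hp), by rw [h]⟩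
    have l1 := (Finset.card_le_card hsub).trans (Finset.card_union_le _ _)
    have l2 := l1.trans (add_le_add Finset.card_image_le Finset.card_image_le)
    have l3 : (s0.card : ℝ) ≤ (Finset.Icc (-⌊H₂⌋) ⌊H₂⌋).card + (Finset.Icc (-⌊H₁⌋) ⌊H₁⌋).card := by
      exact_mod_cast l2
    have := card_box h1
    have := card_box (h1.trans h12)
    linarith
  have hb1 : (s'.card : ℝ) ≤ 2 * D * ((4 * (H₁ * H₂) / c + 1) * c.divisors.card) := by
    have habs : ∀ p ∈ s, |((p.1 * p.2 : ℤ) : ℝ)| ≤ H₁ * H₂ := by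
      intro p hp
      push_cast
      rw [abs_mul]
      exact mul_le_mul (hs1 p hp) (hs2 p hp) (abs_nonneg _) (by linarith)
    set t := s'.image (fun p => p.1 * p.2) with ht
    have hv := card_values c hc a ha (H₁ * H₂) hH t (by
      intro k hk
      obtain ⟨p, hp, rfl⟩ := Finset.mem_image.mp hk
      exact habs p (Finset.mem_filter.mp hp).1) (by
      intro k hk
      obtain ⟨p, hp, rfl⟩ := Finset.mem_image.mp hk
      exact hd p (Finset.mem_filter.mp hp).1)
    have hfib := Finset.card_eq_sum_card_image (fun p : ℤ × ℤ => p.1 * p.2) s'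
    rw [hfib]; push_cast
    calc _ ≤ ∑ _n ∈ t, 2 * D := by
          refine Finset.sum_le_sum fun n hn => ?_
          obtain ⟨p, hp, rfl⟩ := Finset.mem_image.mp hn
          have hp' := Finset.mem_filter.mp hp
          have hne : p.1 * p.2 ≠ 0 := hp'.2
          have l1 := card_prod_fiber (p.1 * p.2) hne
            (s'.filter (fun q => q.1 * q.2 = p.1 * p.2)) (fun q hq => (Finset.mem_filter.mp hq).2)
          have l2 := hD (p.1 * p.2).natAbs (by simpa using hne) (by
            rw [Nat.cast_natAbs, Int.cast_abs]
            exact habs p hp'.1)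
          calc _ ≤ ((2 * (p.1 * p.2).natAbs.divisors.card : ℕ) : ℝ) := by exact_mod_cast l1
            _ ≤ _ := by push_cast; linarith
      _ = 2 * D * t.card := by rw [Finset.sum_const, nsmul_eq_mul]; ring
      _ ≤ _ := mul_le_mul_of_nonneg_left hv (by positivity)
  have : (s.card : ℝ) = s'.card + s0.card := by exact_mod_cast hsum.symm
  linarith

lemma isCoprime_of_isUnit (c : ℕ) (a : ℤ) (h : IsUnit (a : ZMod c)) : IsCoprime a (c : ℤ) := by
  obtain ⟨b, hb⟩ := h.exists_right_inv
  obtain ⟨b, rfl⟩ := ZMod.intCast_surjective b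
  have : ((a * b - 1 : ℤ) : ZMod c) = 0 := by push_cast; rw [hb, sub_self]
  rw [zmod_dvd_iff] at this
  obtain ⟨q, hq⟩ := this
  exact ⟨b, -q, by linarith⟩

/-- From the quadruples to pairs. -/
lemma card_quads (c : ℕ) (hc : 0 < c) (a₁ a₂ : ℤ) (ha₁ : IsCoprime a₁ (c : ℤ))
    (ha₂ : IsCoprime a₂ (c : ℤ)) (H₁ H₂ C₀ : ℝ) (h1 : 1 ≤ H₁) (h12 : H₁ ≤ H₂) (h2c : H₂ ≤ C₀ * c)
    (s : Finset (ℤ × ℤ × ℤ × ℤ))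
    (hs3 : ∀ h ∈ s, |(h.2.2.1 : ℝ)| ≤ H₁)
    (hs4 : ∀ h ∈ s, |(h.2.2.2 : ℝ)| ≤ H₂)
    (hd3 : ∀ h ∈ s, ((a₁ * h.2.2.1 : ℤ) : ZMod c) =
      -(1 - (a₁ * h.1 : ℤ) * (a₂ * h.2.1 : ℤ)) * (a₁ * h.1 : ℤ))
    (hd4 : ∀ h ∈ s, ((a₂ * h.2.2.2 : ℤ) : ZMod c) =
      -(1 - (a₁ * h.1 : ℤ) * (a₂ * h.2.1 : ℤ)) * (a₂ * h.2.1 : ℤ)) :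
    (s.card : ℝ) ≤ (2 * C₀ + 1) ^ 2 * (s.image (fun h => (h.1, h.2.1))).card := by
  classical
  have hc' : (0 : ℝ) < c := by exact_mod_cast hc
  have hfib := Finset.card_eq_sum_card_image (fun h : ℤ × ℤ × ℤ × ℤ => (h.1, h.2.1)) s
  have cl : ∀ (H : ℝ) (t : Finset ℤ) (a : ℤ), 1 ≤ H → H ≤ H₂ → IsCoprime a (c : ℤ) →
      (∀ k ∈ t, |(k : ℝ)| ≤ H) → (∀ k ∈ t, ∀ l ∈ t, ((a * k : ℤ) : ZMod c) = (a * l : ℤ)) →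
      (t.card : ℝ) ≤ 2 * C₀ + 1 := by
    intro H t a hH hH2 ha ht hkl
    have := card_class c hc H (by linarith) t ht (by
      intro k hk l hl
      have h := hkl k hk l hl
      rw [← sub_eq_zero, ← Int.cast_sub, zmod_dvd_iff] at h
      rw [← mul_sub] at h
      exact ha.symm.dvd_of_dvd_mul_left h)
    have h3 : 2 * H / c ≤ 2 * C₀ := by rw [div_le_iff₀ hc']; linarith
    linarith
  rw [hfib]; push_cast
  calc _ ≤ ∑ _p ∈ s.image (fun h => (h.1, h.2.1)), (2 * C₀ + 1) ^ 2 := by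
        refine Finset.sum_le_sum fun p _ => ?_
        set u := s.filter (fun h => (h.1, h.2.1) = p) with hu
        have hup : ∀ h ∈ u, h ∈ s ∧ h.1 = p.1 ∧ h.2.1 = p.2 := by
          intro h hh
          obtain ⟨q1, q2⟩ := Finset.mem_filter.mp hh
          exact ⟨q1, by rw [← q2], by rw [← q2]⟩
        have l0 : u.card ≤ ((u.image (fun h => h.2.2.1)) ×ˢ (u.image (fun h => h.2.2.2))).card := by
          refine Finset.card_le_card_of_injOn (fun h => h.2.2) ?_ ?_
          · intro h hh
            have hh : h ∈ u := hh
            simp only [Finset.coe_product, Set.mem_prod, Finset.mem_coe]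
            exact ⟨Finset.mem_image_of_mem (fun h : ℤ × ℤ × ℤ × ℤ => h.2.2.1) hh,
              Finset.mem_image_of_mem (fun h : ℤ × ℤ × ℤ × ℤ => h.2.2.2) hh⟩
          · intro h hh k hk e
            obtain ⟨_, q1, q2⟩ := hup h hh
            obtain ⟨_, r1, r2⟩ := hup k hk
            exact Prod.ext (q1.trans r1.symm) (Prod.ext (q2.trans r2.symm) e)
        rw [Finset.card_product] at l0
        have l1 : ((u.image (fun h => h.2.2.1)).card : ℝ) ≤ 2 * C₀ + 1 := by
          refine cl H₁ _ a₁ h1 h12 ha₁ ?_ ?_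
          · intro k hk
            obtain ⟨h, hh, rfl⟩ := Finset.mem_image.mp hk
            exact hs3 h (hup h hh).1
          · intro k hk l hl
            obtain ⟨h, hh, rfl⟩ := Finset.mem_image.mp hk
            obtain ⟨g, hg, rfl⟩ := Finset.mem_image.mp hl
            obtain ⟨q0, q1, q2⟩ := hup h hh
            obtain ⟨r0, r1, r2⟩ := hup g hg
            rw [hd3 h q0, hd3 g r0, q1, q2, r1, r2]
        have l2 : ((u.image (fun h => h.2.2.2)).card : ℝ) ≤ 2 * C₀ + 1 := by
          refine cl H₂ _ a₂ (h1.trans h12) le_rfl ha₂ ?_ ?_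
          · intro k hk
            obtain ⟨h, hh, rfl⟩ := Finset.mem_image.mp hk
            exact hs4 h (hup h hh).1
          · intro k hk l hl
            obtain ⟨h, hh, rfl⟩ := Finset.mem_image.mp hk
            obtain ⟨g, hg, rfl⟩ := Finset.mem_image.mp hl
            obtain ⟨q0, q1, q2⟩ := hup h hh
            obtain ⟨r0, r1, r2⟩ := hup g hg
            rw [hd4 h q0, hd4 g r0, q1, q2, r1, r2]
        calc (u.card : ℝ) ≤ (u.image (fun h => h.2.2.1)).card * (u.image (fun h => h.2.2.2)).card := by
              exact_mod_cast l0
          _ ≤ (2 * C₀ + 1) * (2 * C₀ + 1) :=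
              mul_le_mul l1 l2 (Nat.cast_nonneg _) ((Nat.cast_nonneg _).trans l1)
          _ = _ := by ring
    _ = _ := by rw [Finset.sum_const, nsmul_eq_mul]; ring

lemma final_bound (ε : ℝ) (hε : 0 < ε) (C₀ : ℝ) (hC₀ : 1 ≤ C₀) : ∃ C : ℝ, 0 < C ∧
    ∀ (c : ℕ), 0 < c → ∀ (a₁ a₂ : ℤ),
      IsUnit ((a₁ : ZMod c)) → IsUnit ((a₂ : ZMod c)) →
      ∀ H₁ H₂ : ℝ, 1 ≤ H₁ → H₁ ≤ H₂ → H₂ ≤ C₀ * (c : ℝ) →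
      ((Nat.card {h : ℤ × ℤ × ℤ × ℤ //
          (|h.1| : ℝ) ≤ H₁ ∧ (|h.2.1| : ℝ) ≤ H₂ ∧
          (|h.2.2.1| : ℝ) ≤ H₁ ∧ (|h.2.2.2| : ℝ) ≤ H₂ ∧
          ∃ γ : ZMod c, γ ^ 2 = 1 ∧
            ((Tm c) ^ (a₁ * h.1) * Sm c * (Tm c) ^ (a₂ * h.2.1) * Sm c *
              (Tm c) ^ (a₁ * h.2.2.1) * Sm c * (Tm c) ^ (a₂ * h.2.2.2) * Sm c).1
              = γ • (1 : Matrix (Fin 2) (Fin 2) (ZMod c))} : ℝ)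
        ≤ C * (c : ℝ) ^ ε * H₂) := by
  classical
  obtain ⟨K, hK1, hK⟩ := divisor_bound (ε / 3) (by positivity)
  set M : ℝ := (C₀ ^ 2) ^ (ε / 3) with hM
  have hM0 : 0 < M := by positivity
  refine ⟨(2 * C₀ + 1) ^ 2 * (6 + 2 * K ^ 2 * M * (4 * C₀ + 1)), by positivity, ?_⟩
  intro c hc a₁ a₂ hu₁ hu₂ H₁ H₂ h1 h12 h2c
  have hc' : (0 : ℝ) < c := by exact_mod_cast hc
  have hc1 : (1 : ℝ) ≤ c := by exact_mod_cast hc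
  have ha₁ := isCoprime_of_isUnit c a₁ hu₁
  have ha₂ := isCoprime_of_isUnit c a₂ hu₂
  set S : Set (ℤ × ℤ × ℤ × ℤ) := {h | (|h.1| : ℝ) ≤ H₁ ∧ (|h.2.1| : ℝ) ≤ H₂ ∧
          (|h.2.2.1| : ℝ) ≤ H₁ ∧ (|h.2.2.2| : ℝ) ≤ H₂ ∧
          ∃ γ : ZMod c, γ ^ 2 = 1 ∧
            ((Tm c) ^ (a₁ * h.1) * Sm c * (Tm c) ^ (a₂ * h.2.1) * Sm c *
              (Tm c) ^ (a₁ * h.2.2.1) * Sm c * (Tm c) ^ (a₂ * h.2.2.2) * Sm c).1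
              = γ • (1 : Matrix (Fin 2) (Fin 2) (ZMod c))} with hS
  have hfin : S.Finite := by
    refine Set.Finite.subset (Finset.finite_toSet ((Finset.Icc (-⌊H₁⌋) ⌊H₁⌋) ×ˢ
      (Finset.Icc (-⌊H₂⌋) ⌊H₂⌋) ×ˢ (Finset.Icc (-⌊H₁⌋) ⌊H₁⌋) ×ˢ (Finset.Icc (-⌊H₂⌋) ⌊H₂⌋))) ?_
    rintro ⟨x, y, z, w⟩ ⟨q1, q2, q3, q4, _⟩
    simp only [Finset.mem_coe, Finset.mem_product]
    exact ⟨abs_le_mem_Icc q1, abs_le_mem_Icc q2, abs_le_mem_Icc q3, abs_le_mem_Icc q4⟩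
  have hcard : Nat.card S = hfin.toFinset.card := by
    rw [Nat.card_coe_set_eq, Set.ncard_eq_toFinset_card S hfin]
  change ((Nat.card S : ℕ) : ℝ) ≤ _
  rw [hcard]
  set s := hfin.toFinset with hs
  have hmem : ∀ h ∈ s, h ∈ S := fun h hh => hfin.mem_toFinset.mp hh
  have ex : ∀ h ∈ s, ((a₁ * h.1 : ℤ) * (a₂ * h.2.1 : ℤ) : ZMod c) *
      ((a₁ * h.1 : ℤ) * (a₂ * h.2.1 : ℤ) - 2) = 0 ∧
      ((a₁ * h.2.2.1 : ℤ) : ZMod c) =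
        -(1 - (a₁ * h.1 : ℤ) * (a₂ * h.2.1 : ℤ)) * (a₁ * h.1 : ℤ) ∧
      ((a₂ * h.2.2.2 : ℤ) : ZMod c) =
        -(1 - (a₁ * h.1 : ℤ) * (a₂ * h.2.1 : ℤ)) * (a₂ * h.2.1 : ℤ) := fun h hh => by
    obtain ⟨_, _, _, _, γ, hγ, e⟩ := hmem h hh
    exact eqn_extract c _ _ _ _ γ hγ e
  have b1 := card_quads c hc a₁ a₂ ha₁ ha₂ H₁ H₂ C₀ h1 h12 h2c s
    (fun h hh => (hmem h hh).2.2.1) (fun h hh => (hmem h hh).2.2.2.1)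
    (fun h hh => (ex h hh).2.1) (fun h hh => (ex h hh).2.2)
  have hcε : (1 : ℝ) ≤ (c : ℝ) ^ ε := Real.one_le_rpow hc1 hε.le
  have hHH : H₁ * H₂ ≤ C₀ ^ 2 * (c : ℝ) ^ 2 := by
    calc H₁ * H₂ ≤ (C₀ * c) * (C₀ * c) :=
          mul_le_mul (h12.trans h2c) h2c (by linarith) (by positivity)
      _ = _ := by ring
  set d := (c : ℝ) ^ (ε / 3) with hd
  have hd0 : 0 < d := by positivity
  have hd3 : d ^ 3 = (c : ℝ) ^ ε := by
    rw [hd, ← Real.rpow_natCast, ← Real.rpow_mul hc'.le]; congr 1; push_cast; ring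
  have hMd : (C₀ ^ 2 * (c : ℝ) ^ 2) ^ (ε / 3) = M * d ^ 2 := by
    rw [Real.mul_rpow (by positivity) (by positivity), hM, hd, ← Real.rpow_natCast (c : ℝ),
      ← Real.rpow_natCast ((c : ℝ) ^ (ε / 3)), ← Real.rpow_mul hc'.le, ← Real.rpow_mul hc'.le,
      mul_comm ((2 : ℕ) : ℝ)]
  have b2 := card_pairs c hc (a₁ * a₂) (ha₁.mul_left ha₂) H₁ H₂ (K * (M * d ^ 2)) h1 h12 (by
      intro n hn hnH
      refine (hK n hn).trans ?_
      rw [← hMd]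
      exact mul_le_mul_of_nonneg_left
        (Real.rpow_le_rpow (by positivity) (hnH.trans hHH) (by positivity)) (by linarith))
    (s.image (fun h => (h.1, h.2.1)))
    (by
      intro p hp
      obtain ⟨h, hh, rfl⟩ := Finset.mem_image.mp hp
      exact (hmem h hh).1)
    (by
      intro p hp
      obtain ⟨h, hh, rfl⟩ := Finset.mem_image.mp hp
      exact (hmem h hh).2.1)
    (by
      intro p hp
      obtain ⟨h, hh, rfl⟩ := Finset.mem_image.mp hp
      have e := (ex h hh).1
      rw [← zmod_dvd_iff]
      push_cast at e ⊢
      linear_combination e)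
  have b3 : 4 * (H₁ * H₂) / c + 1 ≤ (4 * C₀ + 1) * H₂ := by
    have : 4 * (H₁ * H₂) / c ≤ 4 * C₀ * H₂ := by
      rw [div_le_iff₀ hc']
      have := mul_le_mul_of_nonneg_right (h12.trans h2c) (by linarith : 0 ≤ H₂)
      linarith
    linarith
  have b4 : (c.divisors.card : ℝ) ≤ K * d := hK c hc.ne'
  have hH2 : 0 < H₂ := by linarith
  have b5 : (4 * (H₁ * H₂) / c + 1) * c.divisors.card ≤ ((4 * C₀ + 1) * H₂) * (K * d) :=
    mul_le_mul b3 b4 (Nat.cast_nonneg _) (by positivity)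
  have hK0 : 0 < K := by linarith
  have b6 : ((s.image (fun h => (h.1, h.2.1))).card : ℝ) ≤
      (6 + 2 * K ^ 2 * M * (4 * C₀ + 1)) * (c : ℝ) ^ ε * H₂ := by
    have b7 := mul_le_mul_of_nonneg_left b5 (by positivity : 0 ≤ 2 * (K * (M * d ^ 2)))
    have b8 : 2 * (K * (M * d ^ 2)) * (((4 * C₀ + 1) * H₂) * (K * d)) =
        2 * K ^ 2 * M * (4 * C₀ + 1) * (c : ℝ) ^ ε * H₂ := by rw [← hd3]; ring
    have b9 : 6 * H₂ ≤ 6 * (c : ℝ) ^ ε * H₂ := by nlinarith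
    rw [b8] at b7
    linarith
  calc _ ≤ _ := b1
    _ ≤ (2 * C₀ + 1) ^ 2 * ((6 + 2 * K ^ 2 * M * (4 * C₀ + 1)) * (c : ℝ) ^ ε * H₂) :=
        mul_le_mul_of_nonneg_left b6 (by positivity)
    _ = _ := by ring

/-- For `c ≥ 1`, units `a₁, a₂` mod `c`, and `1 ≤ H₁ ≤ H₂ ≤ C₀·c`,
the number of integer solutions `(h₁, h₂, h₃, h₄)` with `|h₁|, |h₃| ≤ H₁`,
`|h₂|, |h₄| ≤ H₂` to `T^{a₁h₁} S T^{a₂h₂} S T^{a₁h₃} S T^{a₂h₄} S = I` in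
`PSL₂(ℤ/cℤ)` is `O_ε(c^ε (H₂ + H₁H₂/c))`; in particular it is `O_ε(c^ε H₂)`. -/
theorem stmt11 : ∀ ε : ℝ, 0 < ε → ∀ C₀ : ℝ, 1 ≤ C₀ → ∃ C : ℝ, 0 < C ∧
    ∀ (c : ℕ), 0 < c → ∀ (a₁ a₂ : ℤ),
      IsUnit ((a₁ : ZMod c)) → IsUnit ((a₂ : ZMod c)) →
      ∀ H₁ H₂ : ℝ, 1 ≤ H₁ → H₁ ≤ H₂ → H₂ ≤ C₀ * (c : ℝ) →
      ((Nat.card {h : ℤ × ℤ × ℤ × ℤ //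
          (|h.1| : ℝ) ≤ H₁ ∧ (|h.2.1| : ℝ) ≤ H₂ ∧
          (|h.2.2.1| : ℝ) ≤ H₁ ∧ (|h.2.2.2| : ℝ) ≤ H₂ ∧
          ∃ γ : ZMod c, γ ^ 2 = 1 ∧
            ((Tm c) ^ (a₁ * h.1) * Sm c * (Tm c) ^ (a₂ * h.2.1) * Sm c *
              (Tm c) ^ (a₁ * h.2.2.1) * Sm c * (Tm c) ^ (a₂ * h.2.2.2) * Sm c).1
              = γ • (1 : Matrix (Fin 2) (Fin 2) (ZMod c))} : ℝ)
        ≤ C * (c : ℝ) ^ ε * (H₂ + H₁ * H₂ / (c : ℝ))) ∧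
      ((Nat.card {h : ℤ × ℤ × ℤ × ℤ //
          (|h.1| : ℝ) ≤ H₁ ∧ (|h.2.1| : ℝ) ≤ H₂ ∧
          (|h.2.2.1| : ℝ) ≤ H₁ ∧ (|h.2.2.2| : ℝ) ≤ H₂ ∧
          ∃ γ : ZMod c, γ ^ 2 = 1 ∧
            ((Tm c) ^ (a₁ * h.1) * Sm c * (Tm c) ^ (a₂ * h.2.1) * Sm c *
              (Tm c) ^ (a₁ * h.2.2.1) * Sm c * (Tm c) ^ (a₂ * h.2.2.2) * Sm c).1
              = γ • (1 : Matrix (Fin 2) (Fin 2) (ZMod c))} : ℝ)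
        ≤ C * (c : ℝ) ^ ε * H₂) := by
  intro ε hε C₀ hC₀
  obtain ⟨C, hC, h⟩ := final_bound ε hε C₀ hC₀
  refine ⟨C, hC, fun c hc a₁ a₂ hu₁ hu₂ H₁ H₂ h1 h12 h2c => ?_⟩
  have b := h c hc a₁ a₂ hu₁ hu₂ H₁ H₂ h1 h12 h2c
  refine ⟨b.trans ?_, b⟩
  have h0 : 0 ≤ H₁ * H₂ / (c : ℝ) := by
    have : 0 ≤ H₁ := by linarith
    have : 0 ≤ H₂ := by linarith
    positivity
  exact mul_le_mul_of_nonneg_left (by linarith) (by positivity)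
end

section
/- Let c be a positive integer, a₁, a₂ units modulo c, and 1 ≤ H₁ ≤ H₂ ≤ C·c. The number of integer solutions (h₁, …, h₆) with |h_i| ≤ H₁ for odd i and |h_i| ≤ H₂ for even i to T^{a₁h₁} S T^{a₂h₂} S T^{a₁h₃} S T^{a₂h₄} S T^{a₁h₅} S T^{a₂h₆} S = I in PSL₂(ℤ/cℤ) is at most O_ε(c^ε (H₂² + H₁²H₂²/c)) for every ε > 0. -/
open Matrix

/-- The divisor bound. -/
lemma div_bound (ε : ℝ) (hε : 0 < ε) : ∃ C : ℝ, 1 ≤ C ∧ ∀ n : ℕ, n ≠ 0 →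
    (n.divisors.card : ℝ) ≤ C * (n : ℝ) ^ ε := by
  obtain ⟨P, hP⟩ := exists_nat_ge ((2 : ℝ) ^ (1 / ε))
  have hlog : 0 < Real.log 2 := Real.log_pos (by norm_num)
  set L : ℝ := 1 + 1 / (ε * Real.log 2) with hL
  have hL1 : 1 ≤ L := by
    have : 0 < 1 / (ε * Real.log 2) := by positivity
    linarith
  have key : ∀ p k : ℕ, p.Prime →
      ((k : ℝ) + 1) ≤ (if p < P then L else 1) * ((p : ℝ) ^ k) ^ ε := by
    intro p k hp
    have hp2 : (2 : ℝ) ≤ p := by exact_mod_cast hp.two_le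
    have hp0 : (0 : ℝ) < p := by linarith
    split_ifs with h
    · have h1 : ((p : ℝ) ^ k) ^ ε = Real.exp (k * ε * Real.log p) := by
        rw [Real.rpow_def_of_pos (by positivity), Real.log_pow]; ring_nf
      have h2 : Real.log 2 ≤ Real.log p := Real.log_le_log (by norm_num) hp2
      have h3 : (k : ℝ) * ε * Real.log 2 + 1 ≤ ((p : ℝ) ^ k) ^ ε := by
        rw [h1]
        refine le_trans ?_ (Real.add_one_le_exp _)
        gcongr
      have h4 : ((k : ℝ) + 1) ≤ L * ((k : ℝ) * ε * Real.log 2 + 1) := by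
        have : L * ((k : ℝ) * ε * Real.log 2 + 1) =
          (k : ℝ) * ε * Real.log 2 + 1 + k + 1 / (ε * Real.log 2) := by
          rw [hL]; field_simp; ring
        rw [this]
        have : 0 ≤ (k : ℝ) * ε * Real.log 2 := by positivity
        have : 0 < 1 / (ε * Real.log 2) := by positivity
        linarith
      calc _ ≤ _ := h4
        _ ≤ _ := by gcongr
    · rw [one_mul]
      have h1 : (2 : ℝ) ≤ (p : ℝ) ^ ε := by
        have : (2 : ℝ) ^ (1 / ε) ≤ p := hP.trans (by exact_mod_cast not_lt.mp h)
        calc (2 : ℝ) = ((2 : ℝ) ^ (1 / ε)) ^ ε := by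
              rw [← Real.rpow_mul (by norm_num)]; field_simp; simp
          _ ≤ _ := by gcongr
      have h2 : ((p : ℝ) ^ k) ^ ε = ((p : ℝ) ^ ε) ^ k := by
        rw [← Real.rpow_natCast, ← Real.rpow_natCast, ← Real.rpow_mul hp0.le,
          ← Real.rpow_mul hp0.le, mul_comm]
      rw [h2]
      calc (k : ℝ) + 1 ≤ 2 ^ k := by exact_mod_cast Nat.lt_two_pow_self
        _ ≤ _ := by gcongr
  refine ⟨L ^ P, one_le_pow₀ hL1, fun n hn => ?_⟩
  rw [Nat.card_divisors hn]
  push_cast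
  calc ∏ x ∈ n.primeFactors, ((n.factorization x : ℝ) + 1)
      ≤ ∏ p ∈ n.primeFactors, ((if p < P then L else 1) * ((p : ℝ) ^ (n.factorization p)) ^ ε) := by
        apply Finset.prod_le_prod
        · intros; positivity
        · intro p hp
          exact key p _ (Nat.prime_of_mem_primeFactors hp)
    _ = (∏ p ∈ n.primeFactors, (if p < P then L else 1)) *
        (∏ p ∈ n.primeFactors, (p : ℝ) ^ (n.factorization p)) ^ ε := by
        rw [Finset.prod_mul_distrib, Real.finsetProd_rpow]
        intros; positivity
    _ ≤ _ := by
        have h1 : (∏ p ∈ n.primeFactors, (p : ℝ) ^ (n.factorization p)) = n := by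
          have := Nat.prod_factorization_pow_eq_self hn
          rw [Finsupp.prod, Nat.support_factorization] at this
          conv_rhs => rw [← this]
          push_cast; rfl
        rw [h1]
        gcongr
        rw [Finset.prod_ite, Finset.prod_const_one, mul_one, Finset.prod_const]
        apply pow_le_pow_right₀ hL1
        calc _ ≤ (Finset.range P).card := Finset.card_le_card (by
              intro p; simp)
          _ = P := Finset.card_range P

/-- integers in an interval, in one class mod m -/
lemma ap_card (S : Finset ℤ) (M m : ℕ) (hm : 0 < m) (h1 : ∀ s ∈ S, |s| ≤ M)
    (h2 : ∀ s ∈ S, ∀ t ∈ S, (m : ℤ) ∣ s - t) : S.card ≤ 2 * M / m + 1 := by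
  rw [← Finset.card_range (2 * M / m + 1)]
  apply Finset.card_le_card_of_injOn (fun s : ℤ => ((s + (M : ℤ)) / (m : ℤ)).toNat)
  · intro s hs
    have := abs_le.mp (h1 s hs)
    simp only [Finset.coe_range, Set.mem_Iio]
    have h3 : (s + M) / m ≤ (2 * M / m : ℤ) := Int.ediv_le_ediv (by exact_mod_cast hm) (by linarith)
    have h4 : ((2 * M / m : ℕ) : ℤ) = (2 * M / m : ℤ) := by push_cast; rfl
    rw [← h4] at h3
    have h5 := Int.toNat_le.mpr h3
    exact Nat.lt_succ_of_le h5
  · intro s hs t ht hst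
    have hs' := abs_le.mp (h1 s hs)
    have ht' := abs_le.mp (h1 t ht)
    have hm' : (0 : ℤ) < m := by exact_mod_cast hm
    have e1 : 0 ≤ (s + M) / (m : ℤ) := Int.ediv_nonneg (by linarith) hm'.le
    have e2 : 0 ≤ (t + M) / (m : ℤ) := Int.ediv_nonneg (by linarith) hm'.le
    have e3 : (s + M) / (m : ℤ) = (t + M) / (m : ℤ) := by
      simp only at hst; omega
    obtain ⟨k, hk⟩ := h2 s hs t ht
    have e4 : s + M = t + M + m * k := by linarith
    rw [e4, Int.add_mul_ediv_left _ _ hm'.ne'] at e3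
    have hk0 : k = 0 := by linarith
    rw [hk0] at hk
    linarith

lemma pair_card (S : Finset (ℤ × ℤ)) (u : ℤ) (hu : u ≠ 0) (h : ∀ p ∈ S, p.1 * p.2 = u) :
    S.card ≤ 2 * u.natAbs.divisors.card := by
  have : 2 * u.natAbs.divisors.card = (u.natAbs.divisors ×ˢ (Finset.univ : Finset Bool)).card := by
    rw [Finset.card_product]; simp [mul_comm]
  rw [this]
  apply Finset.card_le_card_of_injOn (fun p => (p.1.natAbs, decide (0 ≤ p.1)))
  · intro p hp
    simp only [Finset.coe_product, Set.mem_prod, Finset.mem_coe, Nat.mem_divisors, Finset.mem_univ,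
      and_true]
    refine ⟨Int.natAbs_dvd_natAbs.mpr ⟨p.2, (h p hp).symm⟩, by simpa using hu⟩
  · intro p hp q hq hpq
    simp only [Prod.mk.injEq, decide_eq_decide] at hpq
    have h1 : p.1 = q.1 := by omega
    have hp' := h p hp
    have hq' := h q hq
    have h0 : p.1 ≠ 0 := by rintro h0; rw [h0, zero_mul] at hp'; exact hu hp'.symm
    have h2 : p.2 = q.2 := by
      apply mul_left_cancel₀ h0
      rw [hp', h1, hq']
    exact Prod.ext h1 h2

lemma sqrt_one_card (c : ℕ) [NeZero c] :
    (Finset.univ.filter (fun γ : ZMod c => γ ^ 2 = 1)).card ≤ 2 * c.divisors.card := by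
  have hc : c ≠ 0 := NeZero.ne c
  have : 2 * c.divisors.card = (c.divisors ×ˢ (Finset.univ : Finset Bool)).card := by
    rw [Finset.card_product]; simp [mul_comm]
  rw [this]
  have hd : ∀ γ : ZMod c, γ ^ 2 = 1 → (c : ℤ) ∣ ((γ.val : ℤ) - 1) * ((γ.val : ℤ) + 1) := by
    intro γ hγ
    rw [← ZMod.intCast_zmod_eq_zero_iff_dvd]
    push_cast
    rw [ZMod.natCast_zmod_val]
    linear_combination hγ
  apply Finset.card_le_card_of_injOn
    (fun γ => (Int.gcd ((γ.val : ℤ) - 1) c, decide (2 * γ.val < c)))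
  · intro p hp
    simp only [Finset.coe_product, Set.mem_prod, Finset.mem_coe, Nat.mem_divisors, Finset.mem_univ,
      and_true]
    refine ⟨?_, hc⟩
    have := Int.gcd_dvd_right ((p.val : ℤ) - 1) c
    exact_mod_cast this
  · intro p hp q hq hpq
    simp only [Prod.mk.injEq, decide_eq_decide] at hpq
    obtain ⟨hg, hlt⟩ := hpq
    have hp2 := hd p (by simpa using hp)
    have hq2 := hd q (by simpa using hq)
    have hgc := Int.gcd_dvd_right ((p.val : ℤ) - 1) c
    have hgp := Int.gcd_dvd_left ((p.val : ℤ) - 1) c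
    have hgq := Int.gcd_dvd_left ((q.val : ℤ) - 1) c
    have key : ∀ y z : ℤ, (c : ℤ) ∣ y * z → (c : ℤ) ∣ Int.gcd y c * z := by
      intro y z h
      rw [Int.gcd_eq_gcd_ab]
      obtain ⟨t, ht⟩ := h
      exact ⟨t * Int.gcdA y c + Int.gcdB y c * z, by linear_combination Int.gcdA y c * ht⟩
    have hp3 := key _ _ hp2
    have hq3 := key _ _ hq2
    rw [← hg] at hgq hq3
    set g : ℤ := (Int.gcd ((p.val : ℤ) - 1) c : ℤ)
    have hsub : (c : ℤ) ∣ g * ((p.val : ℤ) - q.val) := by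
      have := dvd_sub hp3 hq3
      rwa [← mul_sub, show ((p.val : ℤ) + 1) - (q.val + 1) = (p.val : ℤ) - q.val by ring] at this
    have h2 : (c : ℤ) ∣ 2 * ((p.val : ℤ) - q.val) := by
      obtain ⟨s, hs⟩ := hgp
      obtain ⟨s', hs'⟩ := hgq
      obtain ⟨t, ht⟩ := hp3
      obtain ⟨r, hr⟩ := hsub
      have e : (p.val : ℤ) - q.val = g * (s - s') := by linear_combination hs - hs'
      refine ⟨t * (s - s') - s * r, ?_⟩
      have : 2 * ((p.val : ℤ) - q.val) = (p.val + 1) * ((p.val : ℤ) - q.val)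
        - (p.val - 1) * ((p.val : ℤ) - q.val) := by ring
      rw [this, hs]
      linear_combination (p.val + 1 : ℤ) * e + (s - s') * ht - s * hr
    have hpl := ZMod.val_lt p
    have hql := ZMod.val_lt q
    apply ZMod.val_injective c
    have : 2 * ((p.val : ℤ) - q.val) = 0 := by
      apply Int.eq_zero_of_abs_lt_dvd h2
      rw [abs_lt]
      constructor <;> omega
    omega

lemma Tm_zpow' {R : Type*} [CommRing R] (T : SpecialLinearGroup (Fin 2) R) (hT : T.1 = !![1, 1; 0, 1])
    (k : ℤ) : (T ^ k).1 = !![1, (k : R); 0, 1] := by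
  have hc : ∀ A B : SpecialLinearGroup (Fin 2) R, (A * B).1 = A.1 * B.1 := fun _ _ => rfl
  have hi : ∀ A : SpecialLinearGroup (Fin 2) R, (A⁻¹).1 = A.1.adjugate := fun _ => rfl
  induction k using Int.induction_on with
  | zero => simp [Matrix.one_fin_two]
  | succ n ih =>
    rw [_root_.zpow_add_one, hc, ih, hT]
    ext i j; fin_cases i <;> fin_cases j <;> simp [Matrix.mul_apply, Fin.sum_univ_two, add_comm]
  | pred n ih =>
    rw [_root_.zpow_sub_one, hc, ih, hi, hT]
    ext i j; fin_cases i <;> fin_cases j <;> simp [Matrix.mul_apply, Fin.sum_univ_two, Matrix.adjugate_fin_two]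
    ring

lemma six_mat {R : Type*} [CommRing R] (T S : SpecialLinearGroup (Fin 2) R)
    (hT : T.1 = !![1, 1; 0, 1]) (hS : S.1 = !![0, -1; 1, 0]) (k₁ k₂ k₃ k₄ k₅ k₆ : ℤ) (γ : R)
    (h : (T ^ k₁ * S * T ^ k₂ * S * T ^ k₃ * S * T ^ k₄ * S * T ^ k₅ * S * T ^ k₆ * S).1
      = γ • (1 : Matrix (Fin 2) (Fin 2) R)) :
    ((k₁ : R) * k₂ - 1 = -γ * (k₄ * k₅ - 1)) ∧
    (((k₁ : R) * k₂ - 1) * k₃ - k₁ = -γ * k₅) ∧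
    (γ * k₆ = k₂ - k₄ * ((k₂ : R) * k₃ - 1)) := by
  have hM : ∀ k : ℤ, (T ^ k).1 * S.1 = !![(k : R), -1; 1, 0] := by
    intro k
    rw [Tm_zpow' T hT, hS]
    ext i j; fin_cases i <;> fin_cases j <;> simp [Matrix.mul_apply, Fin.sum_univ_two]
  have hc : ∀ A B : SpecialLinearGroup (Fin 2) R, (A * B).1 = A.1 * B.1 := fun _ _ => rfl
  simp only [hc] at h
  rw [hM, Matrix.mul_assoc _ _ S.1, hM, Matrix.mul_assoc _ _ S.1, hM, Matrix.mul_assoc _ _ S.1, hM,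
    Matrix.mul_assoc _ _ S.1, hM, Matrix.mul_assoc _ _ S.1, hM] at h
  have e11 := congrFun (congrFun h 0) 0
  have e12 := congrFun (congrFun h 0) 1
  have e21 := congrFun (congrFun h 1) 0
  have e22 := congrFun (congrFun h 1) 1
  simp [Matrix.mul_apply, Fin.sum_univ_two] at e11 e12 e21 e22
  generalize (k₁ : R) = x1 at *
  generalize (k₂ : R) = x2 at *
  generalize (k₃ : R) = x3 at *
  generalize (k₄ : R) = x4 at *
  generalize (k₅ : R) = x5 at *
  generalize (k₆ : R) = x6 at *
  refine ⟨?_, ?_, ?_⟩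
  · linear_combination -(x4 * x5 - 1) * e11 - (x4 * x5 * x6 - x6 - x4) * e12
  · linear_combination (-x5) * e11 - (x5 * x6 - 1) * e12
  · linear_combination -e21 - x6 * e22

/-- box of pairs -/
noncomputable def bx (n₁ n₂ : ℕ) : Finset (ℤ × ℤ) := Finset.Icc (-(n₁ : ℤ)) n₁ ×ˢ Finset.Icc (-(n₂ : ℤ)) n₂

/-- pairs in the box with given product -/
noncomputable def pr (n₁ n₂ : ℕ) (u : ℤ) : Finset (ℤ × ℤ) := (bx n₁ n₂).filter (fun p => p.1 * p.2 = u)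

/-- the product of a pair -/
def pd (p : ℤ × ℤ) : ℤ := p.1 * p.2

lemma bx_abs {n₁ n₂ : ℕ} {p : ℤ × ℤ} (h : p ∈ bx n₁ n₂) : |p.1| ≤ n₁ ∧ |p.2| ≤ n₂ := by
  simp only [bx, Finset.mem_product, Finset.mem_Icc] at h
  exact ⟨abs_le.mpr h.1, abs_le.mpr h.2⟩

lemma pd_abs {n₁ n₂ : ℕ} {p : ℤ × ℤ} (h : p ∈ bx n₁ n₂) : |pd p| ≤ ((n₁ * n₂ : ℕ) : ℤ) := by
  obtain ⟨h1, h2⟩ := bx_abs h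
  rw [pd, abs_mul]; push_cast
  exact mul_le_mul h1 h2 (abs_nonneg _) (by positivity)

lemma pr_zero_card (n₁ n₂ : ℕ) (h1 : 1 ≤ n₁) (h2 : n₁ ≤ n₂) : (pr n₁ n₂ 0).card ≤ 6 * n₂ := by
  have : pr n₁ n₂ 0 ⊆ (({0} : Finset ℤ) ×ˢ Finset.Icc (-(n₂ : ℤ)) n₂) ∪
      (Finset.Icc (-(n₁ : ℤ)) n₁ ×ˢ ({0} : Finset ℤ)) := by
    rintro ⟨a, b⟩ h
    simp only [pr, bx, Finset.mem_filter, Finset.mem_product, mul_eq_zero, Finset.mem_Icc] at h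
    simp only [Finset.mem_union, Finset.mem_product, Finset.mem_singleton, Finset.mem_Icc]
    tauto
  refine (Finset.card_le_card this).trans ((Finset.card_union_le _ _).trans ?_)
  simp only [Finset.card_product, Finset.card_singleton, Int.card_Icc]
  omega

lemma Q_card (n₁ n₂ : ℕ) (Q : Finset ((ℤ × ℤ) × (ℤ × ℤ))) (D₁ D₂ : ℕ)
    (hb : ∀ q ∈ Q, q.1 ∈ bx n₁ n₂ ∧ q.2 ∈ bx n₁ n₂)
    (h1 : ∀ q ∈ Q, (pr n₁ n₂ (pd q.1)).card ≤ D₁)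
    (h2 : ∀ q ∈ Q, (pr n₁ n₂ (pd q.2)).card ≤ D₂) :
    Q.card ≤ (D₁ * D₂) * (Q.image (fun q => (pd q.1, pd q.2))).card := by
  apply Finset.card_le_mul_card_image
  intro b hb'
  obtain ⟨q, hq, rfl⟩ := Finset.mem_image.mp hb'
  calc _ ≤ (pr n₁ n₂ (pd q.1) ×ˢ pr n₁ n₂ (pd q.2)).card := by
        apply Finset.card_le_card
        intro r hr
        simp only [Finset.mem_filter, Prod.mk.injEq] at hr
        simp only [Finset.mem_product, pr, Finset.mem_filter]
        exact ⟨⟨(hb r hr.1).1, hr.2.1⟩, ⟨(hb r hr.1).2, hr.2.2⟩⟩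
    _ ≤ _ := by
        rw [Finset.card_product]
        exact Nat.mul_le_mul (h1 q hq) (h2 q hq)

lemma zmod_dvd_of_unit {c : ℕ} {b w : ZMod c} (hb : IsUnit b) (s t : ℤ)
    (hs : b * s = w) (ht : b * t = w) : (c : ℤ) ∣ s - t := by
  rw [← ZMod.intCast_zmod_eq_zero_iff_dvd]
  push_cast
  have : b * ((s : ZMod c) - t) = 0 := by linear_combination hs - ht
  exact (hb.mul_right_eq_zero).mp this

lemma unit_coprime {c : ℕ} {y : ℤ} (h : IsUnit ((y : ℤ) : ZMod c)) : IsCoprime y (c : ℤ) := by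
  obtain ⟨z, hz⟩ := h.exists_right_inv
  obtain ⟨t, rfl⟩ := ZMod.intCast_surjective z
  have : (((y * t - 1 : ℤ)) : ZMod c) = 0 := by push_cast; linear_combination hz
  rw [ZMod.intCast_zmod_eq_zero_iff_dvd] at this
  obtain ⟨k, hk⟩ := this
  exact ⟨t, -k, by linear_combination hk⟩

/-- the case of nonzero products -/
lemma P_card (c n₁ n₂ : ℕ) (hc : 0 < c) (b : ℤ) (hb : IsUnit (b : ZMod c))
    (γ : ZMod c) (hγ : γ ^ 2 = 1) (D : ℕ)
    (hD : ∀ u : ℤ, u ≠ 0 → |u| ≤ ((n₁ * n₂ : ℕ) : ℤ) → (pr n₁ n₂ u).card ≤ D)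
    (g : ℕ) (hg : g ∣ c)
    (Q : Finset ((ℤ × ℤ) × (ℤ × ℤ)))
    (hQ : ∀ q ∈ Q, q.1 ∈ bx n₁ n₂ ∧ q.2 ∈ bx n₁ n₂)
    (h1 : ∀ q ∈ Q, pd q.1 ≠ 0) (h2 : ∀ q ∈ Q, pd q.2 ≠ 0)
    (hE : ∀ q ∈ Q, (b : ZMod c) * (pd q.1) - 1 = -γ * (b * (pd q.2) - 1))
    (hG : ∀ q ∈ Q, (g : ℤ) ∣ b * pd q.1 - 1) :
    Q.card ≤ (D * D) * ((2 * (n₁ * n₂) / c + 1) * (2 * (n₁ * n₂) / g + 1)) := by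
  refine (Q_card n₁ n₂ Q D D hQ (fun q hq => hD _ (h1 q hq) (pd_abs (hQ q hq).1))
    (fun q hq => hD _ (h2 q hq) (pd_abs (hQ q hq).2))).trans ?_
  apply Nat.mul_le_mul_left
  have hγu : IsUnit γ := IsUnit.of_mul_eq_one γ (by rw [← sq]; exact hγ)
  set R := Q.image (fun q => (pd q.1, pd q.2)) with hR
  refine (Finset.card_le_mul_card_image (f := Prod.fst) R (2 * (n₁ * n₂) / c + 1) ?_).trans ?_
  · intro u hu
    rw [← Finset.card_image_of_injOn (f := Prod.snd)]
    · apply ap_card _ _ _ hc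
      · intro v hv
        simp only [hR, Finset.mem_image, Finset.mem_filter] at hv
        obtain ⟨r, ⟨⟨q, hq, rfl⟩, _⟩, rfl⟩ := hv
        exact pd_abs (hQ q hq).2
      · intro v hv w hw
        simp only [hR, Finset.mem_image, Finset.mem_filter] at hv hw
        obtain ⟨r, ⟨⟨q, hq, rfl⟩, e1⟩, rfl⟩ := hv
        obtain ⟨r', ⟨⟨q', hq', rfl⟩, e2⟩, rfl⟩ := hw
        simp only at e1 e2 ⊢
        have E1 := hE q hq
        have E2 := hE q' hq'
        rw [e1] at E1
        rw [e2] at E2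
        apply zmod_dvd_of_unit (hγu.mul hb) (w := γ - ((b : ZMod c) * (u : ZMod c) - 1))
        · linear_combination E1
        · linear_combination E2
    · intro r hr r' hr' e
      simp only [Finset.coe_filter, Set.mem_ofPred_eq] at hr hr'
      exact Prod.ext (hr.2.trans hr'.2.symm) e
  · apply Nat.mul_le_mul_left
    apply ap_card _ _ _ (Nat.pos_of_dvd_of_pos hg hc)
    · intro v hv
      simp only [hR, Finset.mem_image] at hv
      obtain ⟨r, ⟨q, hq, rfl⟩, rfl⟩ := hv
      exact pd_abs (hQ q hq).1
    · intro v hv w hw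
      simp only [hR, Finset.mem_image] at hv hw
      obtain ⟨r, ⟨q, hq, rfl⟩, rfl⟩ := hv
      obtain ⟨r', ⟨q', hq', rfl⟩, rfl⟩ := hw
      have := dvd_sub (hG q hq) (hG q' hq')
      have cop : IsCoprime (g : ℤ) b := by
        have := (unit_coprime hb).symm
        exact this.of_isCoprime_of_dvd_left (by exact_mod_cast hg)
      apply cop.dvd_of_dvd_mul_left
      convert this using 1
      simp only; ring

/-- both products are zero -/
lemma Z_card (n₁ n₂ : ℕ) (h1 : 1 ≤ n₁) (h2 : n₁ ≤ n₂)
    (Q : Finset ((ℤ × ℤ) × (ℤ × ℤ)))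
    (hQ : ∀ q ∈ Q, q.1 ∈ bx n₁ n₂ ∧ q.2 ∈ bx n₁ n₂)
    (hu : ∀ q ∈ Q, pd q.1 = 0) (hv : ∀ q ∈ Q, pd q.2 = 0) :
    Q.card ≤ (6 * n₂) * (6 * n₂) := by
  have := Q_card n₁ n₂ Q (6 * n₂) (6 * n₂) hQ
    (fun q hq => by rw [hu q hq]; exact pr_zero_card _ _ h1 h2)
    (fun q hq => by rw [hv q hq]; exact pr_zero_card _ _ h1 h2)
  refine this.trans ((Nat.mul_le_mul_left _ ?_).trans_eq (mul_one _))
  apply Finset.card_le_one.mpr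
  intro a ha b hb
  obtain ⟨q, hq, rfl⟩ := Finset.mem_image.mp ha
  obtain ⟨q', hq', rfl⟩ := Finset.mem_image.mp hb
  simp [hu q hq, hv q hq, hu q' hq', hv q' hq']

lemma Z1_card (c n₁ n₂ : ℕ) (hc : 0 < c) (h1 : 1 ≤ n₁) (h2 : n₁ ≤ n₂) (b : ℤ)
    (hb : IsUnit (b : ZMod c)) (γ : ZMod c) (hγ : γ ^ 2 = 1) (D : ℕ)
    (hD : ∀ u : ℤ, u ≠ 0 → |u| ≤ ((n₁ * n₂ : ℕ) : ℤ) → (pr n₁ n₂ u).card ≤ D)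
    (Q : Finset ((ℤ × ℤ) × (ℤ × ℤ)))
    (hQ : ∀ q ∈ Q, q.1 ∈ bx n₁ n₂ ∧ q.2 ∈ bx n₁ n₂)
    (hE : ∀ q ∈ Q, (b : ZMod c) * (pd q.1) - 1 = -γ * (b * (pd q.2) - 1))
    (hu : ∀ q ∈ Q, pd q.1 = 0) (hv : ∀ q ∈ Q, pd q.2 ≠ 0) :
    Q.card ≤ (6 * n₂ * D) * (2 * (n₁ * n₂) / c + 1) := by
  have := Q_card n₁ n₂ Q (6 * n₂) D hQ
    (fun q hq => by rw [hu q hq]; exact pr_zero_card _ _ h1 h2)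
    (fun q hq => hD _ (hv q hq) (pd_abs (hQ q hq).2))
  refine this.trans (Nat.mul_le_mul_left _ ?_)
  have hγu : IsUnit γ := IsUnit.of_mul_eq_one γ (by rw [← sq]; exact hγ)
  rw [← Finset.card_image_of_injOn (f := Prod.snd)]
  · apply ap_card _ _ _ hc
    · intro v hv
      simp only [Finset.mem_image] at hv
      obtain ⟨r, ⟨q, hq, rfl⟩, rfl⟩ := hv
      exact pd_abs (hQ q hq).2
    · intro v hv w hw
      simp only [Finset.mem_image] at hv hw
      obtain ⟨r, ⟨q, hq, rfl⟩, rfl⟩ := hv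
      obtain ⟨r', ⟨q', hq', rfl⟩, rfl⟩ := hw
      have E1 := hE q hq
      have E2 := hE q' hq'
      rw [hu q hq] at E1
      rw [hu q' hq'] at E2
      push_cast at E1 E2
      apply zmod_dvd_of_unit (hγu.mul hb) (w := γ + 1)
      · linear_combination E1
      · linear_combination E2
  · intro r hr r' hr' e
    obtain ⟨q, hq, rfl⟩ := Finset.mem_image.mp hr
    obtain ⟨q', hq', rfl⟩ := Finset.mem_image.mp hr'
    exact Prod.ext ((hu q hq).trans (hu q' hq').symm) e

lemma Z2_card (c n₁ n₂ : ℕ) (hc : 0 < c) (h1 : 1 ≤ n₁) (h2 : n₁ ≤ n₂) (b : ℤ)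
    (hb : IsUnit (b : ZMod c)) (γ : ZMod c) (D : ℕ)
    (hD : ∀ u : ℤ, u ≠ 0 → |u| ≤ ((n₁ * n₂ : ℕ) : ℤ) → (pr n₁ n₂ u).card ≤ D)
    (Q : Finset ((ℤ × ℤ) × (ℤ × ℤ)))
    (hQ : ∀ q ∈ Q, q.1 ∈ bx n₁ n₂ ∧ q.2 ∈ bx n₁ n₂)
    (hE : ∀ q ∈ Q, (b : ZMod c) * (pd q.1) - 1 = -γ * (b * (pd q.2) - 1))
    (hu : ∀ q ∈ Q, pd q.1 ≠ 0) (hv : ∀ q ∈ Q, pd q.2 = 0) :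
    Q.card ≤ (D * (6 * n₂)) * (2 * (n₁ * n₂) / c + 1) := by
  have := Q_card n₁ n₂ Q D (6 * n₂) hQ
    (fun q hq => hD _ (hu q hq) (pd_abs (hQ q hq).1))
    (fun q hq => by rw [hv q hq]; exact pr_zero_card _ _ h1 h2)
  refine this.trans (Nat.mul_le_mul_left _ ?_)
  rw [← Finset.card_image_of_injOn (f := Prod.fst)]
  · apply ap_card _ _ _ hc
    · intro v hv
      simp only [Finset.mem_image] at hv
      obtain ⟨r, ⟨q, hq, rfl⟩, rfl⟩ := hv
      exact pd_abs (hQ q hq).1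
    · intro v hv' w hw
      simp only [Finset.mem_image] at hv' hw
      obtain ⟨r, ⟨q, hq, rfl⟩, rfl⟩ := hv'
      obtain ⟨r', ⟨q', hq', rfl⟩, rfl⟩ := hw
      have E1 := hE q hq
      have E2 := hE q' hq'
      rw [hv q hq] at E1
      rw [hv q' hq'] at E2
      push_cast at E1 E2
      apply zmod_dvd_of_unit hb (w := 1 + γ)
      · linear_combination E1
      · linear_combination E2
  · intro r hr r' hr' e
    obtain ⟨q, hq, rfl⟩ := Finset.mem_image.mp hr
    obtain ⟨q', hq', rfl⟩ := Finset.mem_image.mp hr'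
    exact Prod.ext e ((hv q hq).trans (hv q' hq').symm)

lemma h3_card (c n : ℕ) (hc : 0 < c) (a y : ℤ) (ha : IsUnit (a : ZMod c)) (w : ZMod c)
    (S : Finset ℤ) (hS : ∀ s ∈ S, |s| ≤ n) (hE : ∀ s ∈ S, (y : ZMod c) * (a * s) = w) :
    S.card ≤ 2 * n / (c / Int.gcd y c) + 1 := by
  have hgc : Int.gcd y c ∣ c := by exact_mod_cast Int.gcd_dvd_right y c
  have hgpos : 0 < Int.gcd y c := Nat.pos_of_dvd_of_pos hgc hc
  apply ap_card _ _ _ (Nat.div_pos (Nat.le_of_dvd hc hgc) hgpos) hS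
  intro s hs t ht
  have h0 : (a : ZMod c) * ((y * (s - t) : ℤ) : ZMod c) = 0 := by
    push_cast; linear_combination hE s hs - hE t ht
  have h1 := (ha.mul_right_eq_zero).mp h0
  rw [ZMod.intCast_zmod_eq_zero_iff_dvd] at h1
  have h2 : (c : ℤ) ∣ Int.gcd y c * (s - t) := by
    rw [Int.gcd_eq_gcd_ab]
    obtain ⟨k, hk⟩ := h1
    exact ⟨k * Int.gcdA y c + Int.gcdB y c * (s - t), by linear_combination Int.gcdA y c * hk⟩
  obtain ⟨d, hd⟩ := hgc
  have hd' : c / Int.gcd y c = d := by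
    exact Nat.div_eq_of_eq_mul_right hgpos hd
  rw [hd']
  have h3 : ((Int.gcd y c : ℕ) : ℤ) * d ∣ Int.gcd y c * (s - t) := by
    have : ((Int.gcd y c : ℕ) : ℤ) * d = c := by exact_mod_cast hd.symm
    rw [this]; exact h2
  exact (mul_dvd_mul_iff_left (by exact_mod_cast hgpos.ne')).mp h3

def pj (h : ℤ × ℤ × ℤ × ℤ × ℤ × ℤ) : (ℤ × ℤ) × (ℤ × ℤ) :=
  ((h.1, h.2.1), (h.2.2.2.2.1, h.2.2.2.1))

lemma main_count (c n₁ n₂ : ℕ) (hc : 0 < c) (h1 : 1 ≤ n₁) (h2 : n₁ ≤ n₂) (a₁ a₂ : ℤ)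
    (ha₁ : IsUnit (a₁ : ZMod c)) (ha₂ : IsUnit (a₂ : ZMod c)) (γ : ZMod c) (hγ : γ ^ 2 = 1) (D : ℕ)
    (hD : ∀ u : ℤ, u ≠ 0 → |u| ≤ ((n₁ * n₂ : ℕ) : ℤ) → (pr n₁ n₂ u).card ≤ D)
    (A : Finset (ℤ × ℤ × ℤ × ℤ × ℤ × ℤ))
    (hA : ∀ h ∈ A, (h.1, h.2.1) ∈ bx n₁ n₂ ∧ (h.2.2.2.2.1, h.2.2.2.1) ∈ bx n₁ n₂ ∧
      (h.2.2.1, h.2.2.2.2.2) ∈ bx n₁ n₂)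
    (hE : ∀ h ∈ A,
      (((a₁ * h.1 : ℤ) : ZMod c) * (a₂ * h.2.1 : ℤ) - 1 =
        -γ * ((a₂ * h.2.2.2.1 : ℤ) * (a₁ * h.2.2.2.2.1 : ℤ) - 1)) ∧
      ((((a₁ * h.1 : ℤ) : ZMod c) * (a₂ * h.2.1 : ℤ) - 1) * (a₁ * h.2.2.1 : ℤ) - (a₁ * h.1 : ℤ) =
        -γ * (a₁ * h.2.2.2.2.1 : ℤ)) ∧
      (γ * (a₂ * h.2.2.2.2.2 : ℤ) = (a₂ * h.2.1 : ℤ) - (a₂ * h.2.2.2.1 : ℤ) *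
        (((a₂ * h.2.1 : ℤ) : ZMod c) * (a₁ * h.2.2.1 : ℤ) - 1))) :
    A.card ≤ (2 * n₂ / c + 1) * ((2 * n₁ / c + 1) * ((6 * n₂) * (6 * n₂) +
      (6 * n₂ * D) * (2 * (n₁ * n₂) / c + 1) + (D * (6 * n₂)) * (2 * (n₁ * n₂) / c + 1)) +
      ∑ g ∈ c.divisors, (2 * n₁ / (c / g) + 1) *
        ((D * D) * ((2 * (n₁ * n₂) / c + 1) * (2 * (n₁ * n₂) / g + 1)))) := by
  have hγu : IsUnit γ := IsUnit.of_mul_eq_one γ (by rw [← sq]; exact hγ)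
  set K := 2 * n₂ / c + 1 with hK
  set b : ℤ := a₁ * a₂ with hb
  have hbu : IsUnit (b : ZMod c) := by rw [hb]; push_cast; exact ha₁.mul ha₂
  set G : (ℤ × ℤ) × (ℤ × ℤ) → ℕ := fun q => Int.gcd (b * pd q.1 - 1) c with hG
  set W : ℕ → ℕ := fun g => 2 * n₁ / (c / g) + 1 with hW
  set Q := A.image pj with hQ
  have hGc : ∀ q, G q ∣ c := fun q => by
    have := Int.gcd_dvd_right (b * pd q.1 - 1) c
    exact_mod_cast this
  have hfib : ∀ q ∈ Q, (A.filter (fun h => pj h = q)).card ≤ K * W (G q) := by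
    intro q hq
    refine (Finset.card_le_mul_card_image (f := fun h => h.2.2.1) _ K ?_).trans ?_
    · intro z hz
      rw [← Finset.card_image_of_injOn (f := fun h : ℤ × ℤ × ℤ × ℤ × ℤ × ℤ => h.2.2.2.2.2)]
      · apply ap_card _ _ _ hc
        · intro s hs
          simp only [Finset.mem_image, Finset.mem_filter] at hs
          obtain ⟨h, ⟨⟨hh, _⟩, _⟩, rfl⟩ := hs
          exact (bx_abs (hA h hh).2.2).2
        · intro s hs t ht
          simp only [Finset.mem_image, Finset.mem_filter] at hs ht
          obtain ⟨h, ⟨⟨hh, e1⟩, e2⟩, rfl⟩ := hs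
          obtain ⟨k, ⟨⟨hk, e3⟩, e4⟩, rfl⟩ := ht
          have e5 := e1.trans e3.symm
          have e6 := e2.trans e4.symm
          simp only [pj, Prod.mk.injEq] at e5
          obtain ⟨⟨f1, f2⟩, f5, f4⟩ := e5
          have E1 := (hE h hh).2.2
          have E2 := (hE k hk).2.2
          rw [← f2, ← f4, ← e6] at E2
          push_cast at E1 E2
          exact zmod_dvd_of_unit (hγu.mul ha₂) _ _ ((mul_assoc _ _ _).trans E1)
            ((mul_assoc _ _ _).trans E2)
      · intro h hh k hk e
        simp only [Finset.coe_filter, Finset.mem_filter, Set.mem_ofPred_eq] at hh hk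
        have e5 := hh.1.2.trans hk.1.2.symm
        have e6 := hh.2.trans hk.2.symm
        simp only [pj, Prod.mk.injEq] at e5
        simp only [Prod.ext_iff]
        exact ⟨e5.1.1, e5.1.2, e6, e5.2.2, e5.2.1, e⟩
    · apply Nat.mul_le_mul_left
      apply h3_card c n₁ hc a₁ _ ha₁ (a₁ * (q.1.1 : ZMod c) - γ * (a₁ * q.2.1))
      · intro s hs
        simp only [Finset.mem_image, Finset.mem_filter] at hs
        obtain ⟨h, ⟨hh, _⟩, rfl⟩ := hs
        exact (bx_abs (hA h hh).2.2).1
      · intro s hs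
        simp only [Finset.mem_image, Finset.mem_filter] at hs
        obtain ⟨h, ⟨hh, rfl⟩, rfl⟩ := hs
        have E := (hE h hh).2.1
        simp only [pj, pd, hb]
        push_cast at E ⊢
        linear_combination E
  have hcard : A.card ≤ ∑ q ∈ Q, K * W (G q) := by
    rw [Finset.card_eq_sum_card_image pj A]
    exact Finset.sum_le_sum hfib
  have hQb : ∀ q ∈ Q, q.1 ∈ bx n₁ n₂ ∧ q.2 ∈ bx n₁ n₂ := by
    intro q hq
    obtain ⟨h, hh, rfl⟩ := Finset.mem_image.mp hq
    exact ⟨(hA h hh).1, (hA h hh).2.1⟩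
  have hQE : ∀ q ∈ Q, (b : ZMod c) * (pd q.1) - 1 = -γ * (b * (pd q.2) - 1) := by
    intro q hq
    obtain ⟨h, hh, rfl⟩ := Finset.mem_image.mp hq
    have E := (hE h hh).1
    simp only [pj, pd, hb]
    push_cast at E ⊢
    linear_combination E
  rw [← Finset.mul_sum] at hcard
  refine hcard.trans (Nat.mul_le_mul_left _ ?_)
  rw [← Finset.sum_filter_add_sum_filter_not Q (fun q => pd q.1 = 0 ∨ pd q.2 = 0)]
  apply Nat.add_le_add
  · skip
    have hG1 : ∀ q ∈ Q.filter (fun q => pd q.1 = 0 ∨ pd q.2 = 0), W (G q) = 2 * n₁ / c + 1 := by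
      intro q hq
      obtain ⟨hq, h0⟩ := Finset.mem_filter.mp hq
      have E := hQE q hq
      have hu : IsUnit (((b * pd q.1 - 1 : ℤ)) : ZMod c) := by
        push_cast
        rcases h0 with h0 | h0
        · rw [h0]; simp
        · rw [E, h0]; simpa using hγu
      have : G q = 1 := by
        have := unit_coprime hu
        rw [Int.isCoprime_iff_gcd_eq_one] at this
        exact this
      simp only [hW, this, Nat.div_one]
    rw [Finset.sum_congr rfl hG1, Finset.sum_const, smul_eq_mul, mul_comm]
    apply Nat.mul_le_mul_left
    have hsub : Q.filter (fun q => pd q.1 = 0 ∨ pd q.2 = 0) ⊆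
        (Q.filter (fun q => pd q.1 = 0 ∧ pd q.2 = 0) ∪ Q.filter (fun q => pd q.1 = 0 ∧ pd q.2 ≠ 0)) ∪
        Q.filter (fun q => pd q.1 ≠ 0 ∧ pd q.2 = 0) := by
      intro q
      simp only [Finset.mem_union, Finset.mem_filter]
      tauto
    refine (Finset.card_le_card hsub).trans ((Finset.card_union_le _ _).trans ?_)
    refine Nat.add_le_add ((Finset.card_union_le _ _).trans (Nat.add_le_add ?_ ?_)) ?_
    · apply Z_card n₁ n₂ h1 h2
      · intro q hq; exact hQb q (Finset.mem_filter.mp hq).1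
      · intro q hq; exact (Finset.mem_filter.mp hq).2.1
      · intro q hq; exact (Finset.mem_filter.mp hq).2.2
    · apply Z1_card c n₁ n₂ hc h1 h2 b hbu γ hγ D hD
      · intro q hq; exact hQb q (Finset.mem_filter.mp hq).1
      · intro q hq; exact hQE q (Finset.mem_filter.mp hq).1
      · intro q hq; exact (Finset.mem_filter.mp hq).2.1
      · intro q hq; exact (Finset.mem_filter.mp hq).2.2
    · apply Z2_card c n₁ n₂ hc h1 h2 b hbu γ D hD
      · intro q hq; exact hQb q (Finset.mem_filter.mp hq).1
      · intro q hq; exact hQE q (Finset.mem_filter.mp hq).1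
      · intro q hq; exact (Finset.mem_filter.mp hq).2.1
      · intro q hq; exact (Finset.mem_filter.mp hq).2.2
  · rw [← Finset.sum_fiberwise_of_maps_to (t := c.divisors) (g := G)
      (fun q _ => Nat.mem_divisors.mpr ⟨hGc q, hc.ne'⟩)]
    apply Finset.sum_le_sum
    intro g hg
    rw [Finset.sum_congr rfl (g := fun _ => W g)
      (fun q hq => by rw [(Finset.mem_filter.mp hq).2]), Finset.sum_const, smul_eq_mul, mul_comm]
    apply Nat.mul_le_mul_left
    have hmem : ∀ q ∈ (Q.filter (fun q => ¬ (pd q.1 = 0 ∨ pd q.2 = 0))).filter (fun q => G q = g),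
        q ∈ Q ∧ pd q.1 ≠ 0 ∧ pd q.2 ≠ 0 ∧ G q = g := by
      intro q hq
      simp only [Finset.mem_filter, not_or] at hq
      exact ⟨hq.1.1, hq.1.2.1, hq.1.2.2, hq.2⟩
    apply P_card c n₁ n₂ hc b hbu γ hγ D hD g (Nat.dvd_of_mem_divisors hg)
    · intro q hq; exact hQb q (hmem q hq).1
    · intro q hq; exact (hmem q hq).2.1
    · intro q hq; exact (hmem q hq).2.2.1
    · intro q hq; exact hQE q (hmem q hq).1
    · intro q hq
      rw [← (hmem q hq).2.2.2]
      exact Int.gcd_dvd_left _ _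

set_option maxHeartbeats 1000000 in
/-- the final numerical inequality -/
lemma real_bound (C₀ : ℝ) (hC₀ : 1 ≤ C₀) (c n₁ n₂ D : ℕ) (hc : 0 < c) (h1 : 1 ≤ n₁) (h2 : n₁ ≤ n₂)
    (hn : (n₂ : ℝ) ≤ C₀ * c) (hD : c.divisors.card ≤ D) :
    (((2 * n₂ / c + 1) * ((2 * n₁ / c + 1) * ((6 * n₂) * (6 * n₂) +
      (6 * n₂ * D) * (2 * (n₁ * n₂) / c + 1) + (D * (6 * n₂)) * (2 * (n₁ * n₂) / c + 1)) +
      ∑ g ∈ c.divisors, (2 * n₁ / (c / g) + 1) *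
        ((D * D) * ((2 * (n₁ * n₂) / c + 1) * (2 * (n₁ * n₂) / g + 1)))) : ℕ) : ℝ) ≤
    (3 * C₀) * ((3 * C₀) * 72 + 18 * C₀) * (D : ℝ) ^ 3 *
      ((n₂ : ℝ) ^ 2 + (n₁ : ℝ) ^ 2 * (n₂ : ℝ) ^ 2 / c) := by
  have hc' : (1 : ℝ) ≤ c := by exact_mod_cast hc
  have hc0 : (0 : ℝ) < c := by linarith
  have h1' : (1 : ℝ) ≤ n₁ := by exact_mod_cast h1
  have h2' : (n₁ : ℝ) ≤ n₂ := by exact_mod_cast h2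
  have hD1 : 1 ≤ D := le_trans (Finset.card_pos.mpr ⟨1, by simp [hc.ne']⟩) hD
  have hD' : (1 : ℝ) ≤ D := by exact_mod_cast hD1
  have hDr : (c.divisors.card : ℝ) ≤ (D : ℝ) := by exact_mod_cast hD
  have hdiv : ∀ a b : ℕ, ((a / b : ℕ) : ℝ) ≤ (a : ℝ) / b := fun a b => Nat.cast_div_le
  set x : ℝ := (n₁ : ℝ) with hx
  set y : ℝ := (n₂ : ℝ) with hy
  set d : ℝ := (D : ℝ) with hd
  set X : ℝ := ((2 * (n₁ * n₂) / c : ℕ) : ℝ) + 1 with hX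
  set B : ℝ := y ^ 2 + x ^ 2 * y ^ 2 / c with hB
  have hX0 : 0 ≤ X := by positivity
  have hXle : X ≤ 2 * (x * y) / c + 1 := by
    rw [hX]; have := hdiv (2 * (n₁ * n₂)) c; push_cast at this; linarith
  have hK : ((2 * n₂ / c : ℕ) : ℝ) + 1 ≤ 3 * C₀ := by
    have := hdiv (2 * n₂) c
    push_cast at this
    have h3 : 2 * y / c ≤ 2 * C₀ := by rw [div_le_iff₀ hc0]; linarith
    linarith
  have hK1 : ((2 * n₁ / c : ℕ) : ℝ) + 1 ≤ 3 * C₀ := by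
    have := hdiv (2 * n₁) c
    push_cast at this
    have h3 : 2 * x / c ≤ 2 * C₀ := by rw [div_le_iff₀ hc0]; linarith
    linarith
  have hxyX : x * y * X ≤ 2 * B := by
    calc x * y * X ≤ x * y * (2 * (x * y) / c + 1) := by gcongr
      _ = x * y + 2 * (x ^ 2 * y ^ 2 / c) := by ring
      _ ≤ y * y + 2 * (x ^ 2 * y ^ 2 / c) := by gcongr
      _ ≤ 2 * B := by rw [hB]; nlinarith [sq_nonneg y]
  have hyX : y * X ≤ 2 * B := by
    refine le_trans ?_ hxyX
    gcongr
    nlinarith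
  have hyB : y * y ≤ B := by
    have : 0 ≤ x ^ 2 * y ^ 2 / c := by positivity
    rw [hB]; linarith [sq y]
  have hB0 : 0 ≤ B := by positivity
  have hd3 : d ≤ d ^ 3 := le_self_pow₀ hD' (by norm_num)
  have hd31 : 1 ≤ d ^ 3 := one_le_pow₀ hD'
  have hsum : ∑ g ∈ c.divisors, (((2 * n₁ / (c / g) : ℕ) : ℝ) + 1) *
        ((d * d) * (X * (((2 * (n₁ * n₂) / g : ℕ) : ℝ) + 1))) ≤ 18 * C₀ * d ^ 3 * B := by
    have hterm : ∀ g ∈ c.divisors, (((2 * n₁ / (c / g) : ℕ) : ℝ) + 1) *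
        ((d * d) * (X * (((2 * (n₁ * n₂) / g : ℕ) : ℝ) + 1))) ≤ 18 * C₀ * d ^ 2 * B := by
      intro g hg
      have hgc := Nat.dvd_of_mem_divisors hg
      have hg0 : 0 < g := Nat.pos_of_dvd_of_pos hgc hc
      have hg1 : (1 : ℝ) ≤ g := by exact_mod_cast hg0
      have hg0' : (0 : ℝ) < g := by linarith
      have hgle : (g : ℝ) ≤ c := by exact_mod_cast Nat.le_of_dvd hc hgc
      have e1 : ((2 * n₁ / (c / g) : ℕ) : ℝ) + 1 ≤ 2 * x * g / c + 1 := by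
        have := hdiv (2 * n₁) (c / g)
        rw [Nat.cast_div hgc hg0'.ne'] at this
        push_cast at this
        rw [div_div_eq_mul_div] at this
        linarith
      have e2 : ((2 * (n₁ * n₂) / g : ℕ) : ℝ) + 1 ≤ 2 * (x * y) / g + 1 := by
        have := hdiv (2 * (n₁ * n₂)) g; push_cast at this; linarith
      have e3 : (2 * x * g / c + 1) * (2 * (x * y) / g + 1) ≤ 9 * C₀ * (x * y) := by
        have f1 : (2 * x * g / c + 1) * (2 * (x * y) / g + 1) =
          4 * (x * (x * y)) / c + 2 * x * (g / c) + 2 * (x * y) / g + 1 := by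
          field_simp; ring
        have f2 : 4 * (x * (x * y)) / c ≤ 4 * C₀ * (x * y) := by
          rw [div_le_iff₀ hc0]
          have : x * (x * y) ≤ (C₀ * c) * (x * y) := by gcongr; linarith
          linarith
        have f3 : 2 * x * (g / c) ≤ 2 * x * 1 := by
          gcongr; rw [div_le_one hc0]; exact hgle
        have f4 : 2 * (x * y) / g ≤ 2 * (x * y) := div_le_self (by positivity) hg1
        have f5 : x ≤ x * y := by nlinarith
        have f6 : x * y ≤ C₀ * (x * y) := by nlinarith
        rw [f1]; linarith
      calc _ = (d * d) * X * ((((2 * n₁ / (c / g) : ℕ) : ℝ) + 1) *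
              (((2 * (n₁ * n₂) / g : ℕ) : ℝ) + 1)) := by ring
        _ ≤ (d * d) * X * ((2 * x * g / c + 1) * (2 * (x * y) / g + 1)) := by gcongr
        _ ≤ (d * d) * X * (9 * C₀ * (x * y)) := by gcongr
        _ = 9 * C₀ * d ^ 2 * (x * y * X) := by ring
        _ ≤ 9 * C₀ * d ^ 2 * (2 * B) := by gcongr
        _ = _ := by ring
    calc _ ≤ ∑ g ∈ c.divisors, 18 * C₀ * d ^ 2 * B := Finset.sum_le_sum hterm
      _ = c.divisors.card * (18 * C₀ * d ^ 2 * B) := by rw [Finset.sum_const, nsmul_eq_mul]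
      _ ≤ d * (18 * C₀ * d ^ 2 * B) := mul_le_mul_of_nonneg_right hDr (by positivity)
      _ = _ := by ring
  have hzero : (6 * y) * (6 * y) + (6 * y * d) * X + (d * (6 * y)) * X ≤ 72 * d ^ 3 * B := by
    calc _ = 36 * (y * y) + 12 * d * (y * X) := by ring
      _ ≤ 36 * B + 12 * d * (2 * B) :=
        add_le_add (mul_le_mul_of_nonneg_left hyB (by norm_num))
          (mul_le_mul_of_nonneg_left hyX (by positivity))
      _ = 36 * (1 * B) + 24 * (d * B) := by ring
      _ ≤ 36 * (d ^ 3 * B) + 24 * (d ^ 3 * B) :=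
        add_le_add (mul_le_mul_of_nonneg_left (mul_le_mul_of_nonneg_right hd31 hB0) (by norm_num))
          (mul_le_mul_of_nonneg_left (mul_le_mul_of_nonneg_right hd3 hB0) (by norm_num))
      _ ≤ _ := by
        have : 0 ≤ d ^ 3 * B := mul_nonneg (zero_le_one.trans hd31) hB0
        linarith
  push_cast
  simp only [← hX, ← hy, ← hd]
  calc _ ≤ (3 * C₀) * ((3 * C₀) * (72 * d ^ 3 * B) + 18 * C₀ * d ^ 3 * B) := by
        gcongr
    _ = _ := by ring

/-- For `c ≥ 1`, units `a₁, a₂` mod `c`, and `1 ≤ H₁ ≤ H₂ ≤ C₀·c`,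
the number of integer solutions `(h₁, …, h₆)` with `|hᵢ| ≤ H₁` for odd `i` and
`|hᵢ| ≤ H₂` for even `i` to
`T^{a₁h₁} S T^{a₂h₂} S T^{a₁h₃} S T^{a₂h₄} S T^{a₁h₅} S T^{a₂h₆} S = I` in
`PSL₂(ℤ/cℤ)` is at most `O_ε(c^ε (H₂² + H₁²H₂²/c))` for every `ε > 0`. -/
theorem stmt12 : ∀ ε : ℝ, 0 < ε → ∀ C₀ : ℝ, 1 ≤ C₀ → ∃ C : ℝ, 0 < C ∧
    ∀ (c : ℕ), 0 < c → ∀ (a₁ a₂ : ℤ),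
      IsUnit ((a₁ : ZMod c)) → IsUnit ((a₂ : ZMod c)) →
      ∀ H₁ H₂ : ℝ, 1 ≤ H₁ → H₁ ≤ H₂ → H₂ ≤ C₀ * (c : ℝ) →
      (Nat.card {h : ℤ × ℤ × ℤ × ℤ × ℤ × ℤ //
          (|h.1| : ℝ) ≤ H₁ ∧ (|h.2.1| : ℝ) ≤ H₂ ∧
          (|h.2.2.1| : ℝ) ≤ H₁ ∧ (|h.2.2.2.1| : ℝ) ≤ H₂ ∧
          (|h.2.2.2.2.1| : ℝ) ≤ H₁ ∧ (|h.2.2.2.2.2| : ℝ) ≤ H₂ ∧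
          ∃ γ : ZMod c, γ ^ 2 = 1 ∧
            ((Tm c) ^ (a₁ * h.1) * Sm c * (Tm c) ^ (a₂ * h.2.1) * Sm c *
              (Tm c) ^ (a₁ * h.2.2.1) * Sm c * (Tm c) ^ (a₂ * h.2.2.2.1) * Sm c *
              (Tm c) ^ (a₁ * h.2.2.2.2.1) * Sm c * (Tm c) ^ (a₂ * h.2.2.2.2.2) * Sm c).1
              = γ • (1 : Matrix (Fin 2) (Fin 2) (ZMod c))} : ℝ)
        ≤ C * (c : ℝ) ^ ε * (H₂ ^ 2 + H₁ ^ 2 * H₂ ^ 2 / (c : ℝ)) := by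
  intro ε hε C₀ hC₀
  obtain ⟨C, hC, hdiv⟩ := div_bound (ε / 8) (by positivity)
  set η := ε / 8 with hη
  have hη0 : 0 < η := by positivity
  set L : ℝ := 2 * C * (C₀ ^ 2) ^ η with hL
  have hC0' : 1 ≤ (C₀ ^ 2) ^ η := Real.one_le_rpow (one_le_pow₀ hC₀) hη0.le
  have hL1 : 2 * C ≤ L := by rw [hL]; nlinarith
  have hLpos : 0 < L := by linarith
  refine ⟨2 * ((3 * C₀) * ((3 * C₀) * 72 + 18 * C₀)) * (2 * L) ^ 4, by positivity, ?_⟩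
  intro c hc a₁ a₂ ha₁ ha₂ H₁ H₂ hH₁ hH hHc
  have : NeZero c := ⟨hc.ne'⟩
  have hc1 : (1 : ℝ) ≤ c := by exact_mod_cast hc
  have hc0 : (0 : ℝ) < c := by linarith
  set n₁ := ⌊H₁⌋₊ with hn₁
  set n₂ := ⌊H₂⌋₊ with hn₂
  have h1 : 1 ≤ n₁ := by rw [hn₁, Nat.one_le_floor_iff]; exact hH₁
  have h2 : n₁ ≤ n₂ := Nat.floor_le_floor hH
  have hx : (n₁ : ℝ) ≤ H₁ := Nat.floor_le (by linarith)
  have hy : (n₂ : ℝ) ≤ H₂ := Nat.floor_le (by linarith)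
  have hn : (n₂ : ℝ) ≤ C₀ * c := hy.trans hHc
  have hx2 : (n₁ : ℝ) ≤ n₂ := by exact_mod_cast h2
  set M : ℝ := (c : ℝ) ^ (2 * η) with hM
  have hM1 : 1 ≤ M := Real.one_le_rpow hc1 (by positivity)
  set D := ⌈L * M⌉₊ with hD
  have hDge : L * M ≤ D := Nat.le_ceil _
  have hDle : (D : ℝ) ≤ 2 * L * M := by
    have := (Nat.ceil_lt_add_one (show 0 ≤ L * M by positivity)).le
    have : 1 ≤ L * M := by nlinarith
    linarith
  have hDc : c.divisors.card ≤ D := by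
    have : (c.divisors.card : ℝ) ≤ D := by
      calc _ ≤ C * (c : ℝ) ^ η := hdiv c hc.ne'
        _ ≤ L * M := by
          gcongr
          · linarith
          · exact Real.rpow_le_rpow_of_exponent_le hc1 (by linarith)
        _ ≤ _ := hDge
    exact_mod_cast this
  have hDp : ∀ u : ℤ, u ≠ 0 → |u| ≤ ((n₁ * n₂ : ℕ) : ℤ) → (pr n₁ n₂ u).card ≤ D := by
    intro u hu hub
    have e1 := pair_card (pr n₁ n₂ u) u hu (fun p hp => (Finset.mem_filter.mp hp).2)
    have e2 := hdiv u.natAbs (by simpa using hu)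
    have e3 : (u.natAbs : ℝ) ≤ C₀ ^ 2 * (c : ℝ) ^ 2 := by
      have : u.natAbs ≤ n₁ * n₂ := by
        rw [Int.abs_eq_natAbs] at hub; exact_mod_cast hub
      calc (u.natAbs : ℝ) ≤ n₁ * n₂ := by exact_mod_cast this
        _ ≤ (C₀ * c) * (C₀ * c) := by gcongr; linarith
        _ = _ := by ring
    have e4 : (u.natAbs : ℝ) ^ η ≤ (C₀ ^ 2) ^ η * M := by
      calc (u.natAbs : ℝ) ^ η ≤ (C₀ ^ 2 * (c : ℝ) ^ 2) ^ η := by gcongr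
        _ = _ := by
          rw [Real.mul_rpow (by positivity) (by positivity), hM, Real.rpow_mul hc0.le]
          norm_num
    have : ((pr n₁ n₂ u).card : ℝ) ≤ D := by
      calc ((pr n₁ n₂ u).card : ℝ) ≤ 2 * u.natAbs.divisors.card := by exact_mod_cast e1
        _ ≤ 2 * (C * (u.natAbs : ℝ) ^ η) := by gcongr
        _ ≤ 2 * (C * ((C₀ ^ 2) ^ η * M)) := by gcongr
        _ = L * M := by rw [hL]; ring
        _ ≤ _ := hDge
    exact_mod_cast this
  classical
  let I₁ := Finset.Icc (-(n₁ : ℤ)) n₁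
  let I₂ := Finset.Icc (-(n₂ : ℤ)) n₂
  let Sol : ZMod c → (ℤ × ℤ × ℤ × ℤ × ℤ × ℤ) → Prop := fun γ h =>
    ((Tm c) ^ (a₁ * h.1) * Sm c * (Tm c) ^ (a₂ * h.2.1) * Sm c *
              (Tm c) ^ (a₁ * h.2.2.1) * Sm c * (Tm c) ^ (a₂ * h.2.2.2.1) * Sm c *
              (Tm c) ^ (a₁ * h.2.2.2.2.1) * Sm c * (Tm c) ^ (a₂ * h.2.2.2.2.2) * Sm c).1
              = γ • (1 : Matrix (Fin 2) (Fin 2) (ZMod c))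
  let A : ZMod c → Finset (ℤ × ℤ × ℤ × ℤ × ℤ × ℤ) := fun γ =>
    (I₁ ×ˢ I₂ ×ˢ I₁ ×ˢ I₂ ×ˢ I₁ ×ˢ I₂).filter (Sol γ)
  let Γ : Finset (ZMod c) := Finset.univ.filter (fun γ => γ ^ 2 = 1)
  have hmem : ∀ (H : ℝ) (h : ℤ), 0 ≤ H → |(h : ℝ)| ≤ H →
      h ∈ Finset.Icc (-((⌊H⌋₊ : ℕ) : ℤ)) (⌊H⌋₊ : ℕ) := by
    intro H h hH0 hh
    rw [Finset.mem_Icc, ← abs_le, Int.abs_eq_natAbs]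
    have : h.natAbs ≤ ⌊H⌋₊ := Nat.le_floor (by rw [Nat.cast_natAbs]; push_cast; exact hh)
    exact_mod_cast this
  have hAcard : ∀ γ ∈ Γ, ((A γ).card : ℝ) ≤ (3 * C₀) * ((3 * C₀) * 72 + 18 * C₀) * (D : ℝ) ^ 3 *
      ((n₂ : ℝ) ^ 2 + (n₁ : ℝ) ^ 2 * (n₂ : ℝ) ^ 2 / c) := by
    intro γ hγ
    refine le_trans ?_ (real_bound C₀ hC₀ c n₁ n₂ D hc h1 h2 hn hDc)
    refine Nat.cast_le.mpr (main_count c n₁ n₂ hc h1 h2 a₁ a₂ ha₁ ha₂ γ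
      (Finset.mem_filter.mp hγ).2 D hDp (A γ) ?_ ?_)
    · intro h hh
      have := (Finset.mem_filter.mp hh).1
      simp only [Finset.mem_product] at this
      simp only [bx, Finset.mem_product]
      tauto
    · intro h hh
      exact six_mat (Tm c) (Sm c) rfl rfl _ _ _ _ _ _ γ (Finset.mem_filter.mp hh).2
  have hΓ : (Γ.card : ℝ) ≤ 2 * D := by
    have e : Γ.card ≤ 2 * D := (sqrt_one_card c).trans (Nat.mul_le_mul_left _ hDc)
    exact_mod_cast e
  refine le_trans (b := ((Γ.biUnion A).card : ℝ)) ?_ ?_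
  · refine Nat.cast_le.mpr ?_
    rw [← Nat.card_eq_finsetCard]
    refine Nat.card_le_card_of_injective
      (fun h => (⟨h.1, ?_⟩ : {x // x ∈ Γ.biUnion A})) ?_
    · obtain ⟨h, b1, b2, b3, b4, b5, b6, γ, hγ, hs⟩ := h
      refine Finset.mem_biUnion.mpr ⟨γ, Finset.mem_filter.mpr ⟨Finset.mem_univ _, hγ⟩,
        Finset.mem_filter.mpr ⟨?_, hs⟩⟩
      have p1 : (0 : ℝ) ≤ H₁ := by linarith
      have p2 : (0 : ℝ) ≤ H₂ := by linarith
      simp only [Finset.mem_product]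
      exact ⟨hmem _ _ p1 b1, hmem _ _ p2 b2, hmem _ _ p1 b3, hmem _ _ p2 b4, hmem _ _ p1 b5,
        hmem _ _ p2 b6⟩
    · intro h k e
      simp only [Subtype.mk.injEq] at e
      exact Subtype.ext e
  · set B : ℝ := ((n₂ : ℝ) ^ 2 + (n₁ : ℝ) ^ 2 * (n₂ : ℝ) ^ 2 / c) with hB
    set E : ℝ := (3 * C₀) * ((3 * C₀) * 72 + 18 * C₀) with hE
    have hE0 : 0 ≤ E := by positivity
    have hB0 : 0 ≤ B := by positivity
    have hBle : B ≤ H₂ ^ 2 + H₁ ^ 2 * H₂ ^ 2 / (c : ℝ) := by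
      rw [hB]; gcongr
    have hMc : M ^ 4 = (c : ℝ) ^ ε := by
      rw [hM, ← Real.rpow_natCast, ← Real.rpow_mul hc0.le, hη]
      congr 1; push_cast; ring
    calc ((Γ.biUnion A).card : ℝ) ≤ ∑ γ ∈ Γ, ((A γ).card : ℝ) := by
          exact_mod_cast Finset.card_biUnion_le
      _ ≤ ∑ γ ∈ Γ, E * (D : ℝ) ^ 3 * B := Finset.sum_le_sum hAcard
      _ = Γ.card * (E * (D : ℝ) ^ 3 * B) := by rw [Finset.sum_const, nsmul_eq_mul]
      _ ≤ (2 * D) * (E * (D : ℝ) ^ 3 * B) := by gcongr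
      _ = 2 * E * (D : ℝ) ^ 4 * B := by ring
      _ ≤ 2 * E * (2 * L * M) ^ 4 * (H₂ ^ 2 + H₁ ^ 2 * H₂ ^ 2 / (c : ℝ)) := by gcongr
      _ = 2 * E * (2 * L) ^ 4 * M ^ 4 * (H₂ ^ 2 + H₁ ^ 2 * H₂ ^ 2 / (c : ℝ)) := by ring
      _ = _ := by rw [hMc]
end

section
/- Let c be a positive integer, d | c, and g ∈ SL₂(ℤ/cℤ) such that d is the largest divisor of c for which g ∈ {γI : γ² = 1} · Γ_c(d). Let f be the largest integer with f² | cd. Then the number of fixed points of g acting on ℙ¹(ℤ/cℤ) is O_ε(c^ε f) for all ε > 0. -/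
namespace Stmt19

open Matrix


variable (c : ℕ)

/-- Primitive pairs `(x, y)` over `ℤ/cℤ`, i.e. with `xℤ/cℤ + yℤ/cℤ = ℤ/cℤ`. -/
def PrimPair : Type := {p : ZMod c × ZMod c // IsCoprime p.1 p.2}

/-- Equivalence by simultaneous scaling by a unit. -/
def projSetoid : Setoid (PrimPair c) where
  r p q := ∃ α : (ZMod c)ˣ, (α : ZMod c) * p.1.1 = q.1.1 ∧ (α : ZMod c) * p.1.2 = q.1.2
  iseqv := by
    constructor
    · intro p; exact ⟨1, by simp, by simp⟩
    · rintro p q ⟨α, h1, h2⟩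
      refine ⟨α⁻¹, ?_, ?_⟩
      · rw [← h1, ← mul_assoc]; simp
      · rw [← h2, ← mul_assoc]; simp
    · rintro p q r ⟨α, h1, h2⟩ ⟨β, h3, h4⟩
      refine ⟨β * α, ?_, ?_⟩
      · rw [Units.val_mul, mul_assoc, h1, h3]
      · rw [Units.val_mul, mul_assoc, h2, h4]

/-- The projective line `ℙ¹(ℤ/cℤ)`. -/
def ProjLine : Type := Quotient (projSetoid c)

/-- Möbius action of `SL₂(ℤ/cℤ)` on primitive pairs. -/
def smulPair (g : SpecialLinearGroup (Fin 2) (ZMod c)) (p : PrimPair c) : PrimPair c :=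
  ⟨(g.1 0 0 * p.1.1 + g.1 0 1 * p.1.2, g.1 1 0 * p.1.1 + g.1 1 1 * p.1.2), by
    obtain ⟨u, v, huv⟩ := p.2
    have hdet : g.1 0 0 * g.1 1 1 - g.1 0 1 * g.1 1 0 = 1 := by
      have h2 := g.2
      rwa [Matrix.det_fin_two] at h2
    exact ⟨u * g.1 1 1 - v * g.1 1 0, -(u * g.1 0 1) + v * g.1 0 0, by
      linear_combination (u * p.1.1 + v * p.1.2) * hdet + huv⟩⟩

lemma smulPair_compat (g : SpecialLinearGroup (Fin 2) (ZMod c)) {p q : PrimPair c}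
    (h : (projSetoid c).r p q) : (projSetoid c).r (smulPair c g p) (smulPair c g q) := by
  obtain ⟨α, h1, h2⟩ := h
  refine ⟨α, ?_, ?_⟩
  · show (α : ZMod c) * (g.1 0 0 * p.1.1 + g.1 0 1 * p.1.2)
      = g.1 0 0 * q.1.1 + g.1 0 1 * q.1.2
    linear_combination (g.1 0 0 : ZMod c) * h1 + (g.1 0 1 : ZMod c) * h2
  · show (α : ZMod c) * (g.1 1 0 * p.1.1 + g.1 1 1 * p.1.2)
      = g.1 1 0 * q.1.1 + g.1 1 1 * q.1.2
    linear_combination (g.1 1 0 : ZMod c) * h1 + (g.1 1 1 : ZMod c) * h2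

/-- Möbius action of `SL₂(ℤ/cℤ)` on the projective line. -/
def act (g : SpecialLinearGroup (Fin 2) (ZMod c)) : ProjLine c → ProjLine c :=
  Quotient.map (smulPair c g) (fun _ _ h => smulPair_compat c g h)

/-- `g` lies in `{γI : γ² = 1}·Γ_c(d)`, i.e. the reduction of `g` mod `d` is a
scalar matrix `γ·I` for some `γ : ℤ/cℤ` with `γ² = 1`. -/
def InScalarCoset (d : ℕ) (hdc : d ∣ c) (g : SpecialLinearGroup (Fin 2) (ZMod c)) : Prop :=
  ∃ γ : ZMod c, γ ^ 2 = 1 ∧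
    (SpecialLinearGroup.map (ZMod.castHom hdc (ZMod d)) g).1
      = (ZMod.castHom hdc (ZMod d) γ) • (1 : Matrix (Fin 2) (Fin 2) (ZMod d))

lemma dcg {q q' x y : ℤ} (h : q' ∣ y) (e : x = y) (e' : q = q') : q ∣ x := by subst e e'; exact h

lemma congr_card (N q r : ℕ) (hN : N = q * r) (hq : 0 < q) (S : Finset ℕ) (hS : ∀ t ∈ S, t < N)
    (hc : ∀ t ∈ S, ∀ s ∈ S, (q : ℤ) ∣ (t : ℤ) - s) : S.card ≤ r := by
  have : S.card ≤ (Finset.range r).card := by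
    apply Finset.card_le_card_of_injOn (fun t => t / q)
    · intro t ht
      have := hS t ht
      simp only [Finset.coe_range, Set.mem_Iio]
      exact Nat.div_lt_of_lt_mul (hN ▸ this)
    · intro t ht s hs h
      have h1 := hc t ht s hs
      have h2 : s % q = t % q := (Nat.modEq_iff_dvd.mpr h1)
      rw [← Nat.div_add_mod t q, ← Nat.div_add_mod s q, h2]
      simp only at h
      rw [h]
  simpa using this

lemma pow_split (p m : ℕ) (hp : p.Prime) (x y : ℤ) (h : (p:ℤ)^m ∣ x * y) :
    (p:ℤ)^(m - m/2) ∣ x ∨ (p:ℤ)^(m - m/2) ∣ y := by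
  have hp' : Prime (p:ℤ) := Nat.prime_iff_prime_int.mp hp
  have : ∃ i j, i + j = m ∧ (p:ℤ)^i ∣ x ∧ (p:ℤ)^j ∣ y := by
    obtain ⟨d1, d2, h1, h2, h3⟩ := exists_dvd_and_dvd_of_dvd_mul h
    have hd1 : d1 ∣ (p:ℤ)^m := ⟨d2, h3⟩
    have hd2 : d2 ∣ (p:ℤ)^m := ⟨d1, by rw [h3]; ring⟩
    obtain ⟨i, hi, hi'⟩ := (dvd_prime_pow hp' m).1 hd1
    obtain ⟨j, hj, hj'⟩ := (dvd_prime_pow hp' m).1 hd2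
    refine ⟨i, j, ?_, hi'.symm.dvd.trans h1, hj'.symm.dvd.trans h2⟩
    have h4 : Associated ((p:ℤ)^m) ((p:ℤ)^(i+j)) := by
      rw [h3, pow_add]; exact hi'.mul_mul hj'
    have h5 := Int.natAbs_eq_iff_associated.2 h4
    simp only [Int.natAbs_pow, Int.natAbs_natCast] at h5
    exact (Nat.pow_right_injective hp.two_le h5).symm
  obtain ⟨i, j, hij, h1, h2⟩ := this
  by_cases hi : m - m/2 ≤ i
  · left; exact (pow_dvd_pow _ hi).trans h1
  · right; exact (pow_dvd_pow _ (by omega)).trans h2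

lemma affine_prim (p k m : ℕ) (hp : p.Prime) (hm : 0 < m) (hmk : m ≤ k) (a b c : ℤ)
    (hprim : ¬ ((p:ℤ) ∣ a ∧ (p:ℤ) ∣ b ∧ (p:ℤ) ∣ c)) (S : Finset ℕ) (hS : ∀ t ∈ S, t < p^k)
    (hz : ∀ t ∈ S, (p:ℤ)^m ∣ a * t^2 + b * t + c) : S.card ≤ 2 * p^(k - (m - m/2)) := by
  classical
  have hp' : Prime (p:ℤ) := Nat.prime_iff_prime_int.mp hp
  rcases S.eq_empty_or_nonempty with rfl | ⟨s, hs⟩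
  · simp
  set q := m - m/2 with hq
  have hq0 : q ≠ 0 := by omega
  have hN : p^k = p^q * p^(k-q) := by rw [← pow_add]; congr 1; omega
  let S1 := S.filter (fun t : ℕ => (p:ℤ)^q ∣ (t:ℤ) - s)
  let S2 := S.filter (fun t : ℕ => (p:ℤ)^q ∣ a * (t + s) + b)
  have hU : S ⊆ S1 ∪ S2 := by
    intro t ht
    have h1 : (p:ℤ)^m ∣ ((t:ℤ) - s) * (a * (t + s) + b) := by
      have := dvd_sub (hz t ht) (hz s hs)
      exact dcg this (by ring) rfl
    simp only [S1, S2, Finset.mem_union, Finset.mem_filter]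
    rcases pow_split p m hp _ _ h1 with h | h
    · exact Or.inl ⟨ht, h⟩
    · exact Or.inr ⟨ht, h⟩
  have c1 : S1.card ≤ p^(k-q) := by
    apply congr_card _ (p^q) _ hN (pow_pos hp.pos _)
    · intro t ht; exact hS t (Finset.mem_filter.1 ht).1
    · intro t ht t' ht'
      have := dvd_sub (Finset.mem_filter.1 ht).2 (Finset.mem_filter.1 ht').2
      push_cast
      exact dcg this (by ring) rfl
  have c2 : S2.card ≤ p^(k-q) := by
    apply congr_card _ (p^q) _ hN (pow_pos hp.pos _)
    · intro t ht; exact hS t (Finset.mem_filter.1 ht).1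
    · intro t ht t' ht'
      have h1 := dvd_sub (Finset.mem_filter.1 ht).2 (Finset.mem_filter.1 ht').2
      have h2 : (p:ℤ)^q ∣ a * ((t:ℤ) - t') := by exact dcg h1 (by ring) rfl
      push_cast
      by_cases ha : (p:ℤ) ∣ a
      · exfalso
        apply hprim
        have h3 := (dvd_pow_self (p:ℤ) hq0).trans (Finset.mem_filter.1 ht).2
        have hb : (p:ℤ) ∣ b := (dvd_add_right (ha.mul_right _)).1 h3
        have h4 := (dvd_pow_self (p:ℤ) hm.ne').trans (hz s hs)
        exact ⟨ha, hb, (dvd_add_right (dvd_add (ha.mul_right _) (hb.mul_right _))).1 h4⟩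
      · exact ((IsCoprime.pow_left ((Prime.coprime_iff_not_dvd hp').2 ha))).dvd_of_dvd_mul_left h2
  calc S.card ≤ (S1 ∪ S2).card := Finset.card_le_card hU
    _ ≤ S1.card + S2.card := Finset.card_union_le _ _
    _ ≤ _ := by omega

lemma affine (p k j : ℕ) (hp : p.Prime) (a b c : ℤ)
    (hj : Nat.gcd (p^k) (Nat.gcd a.natAbs (Nat.gcd b.natAbs c.natAbs)) = p^j)
    (S : Finset ℕ) (hS : ∀ t ∈ S, t < p^k)
    (hz : ∀ t ∈ S, ((p^k : ℕ):ℤ) ∣ a * t^2 + b * t + c) : S.card ≤ 2 * p^((k+j)/2) := by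
  have hjk : j ≤ k := (Nat.pow_dvd_pow_iff_le_right hp.one_lt).1 (hj ▸ Nat.gcd_dvd_left _ _)
  have hd : p^j ∣ (Nat.gcd a.natAbs (Nat.gcd b.natAbs c.natAbs)) := hj ▸ Nat.gcd_dvd_right _ _
  obtain ⟨h1, h23⟩ := Nat.dvd_gcd_iff.1 hd
  obtain ⟨h2, h3⟩ := Nat.dvd_gcd_iff.1 h23
  obtain ⟨a', rfl⟩ := Int.natCast_dvd.2 h1
  obtain ⟨b', rfl⟩ := Int.natCast_dvd.2 h2
  obtain ⟨c', rfl⟩ := Int.natCast_dvd.2 h3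
  rcases hjk.eq_or_lt with rfl | hlt
  · have : S.card ≤ p^j := by
      have : S ⊆ Finset.range (p^j) := fun t ht => Finset.mem_range.2 (hS t ht)
      simpa using Finset.card_le_card this
    have e : (j + j)/2 = j := by omega
    rw [e]; omega
  · have e : (k + j)/2 = k - ((k-j) - (k-j)/2) := by omega
    rw [e]
    apply affine_prim p k (k-j) hp (by omega) (by omega) a' b' c' _ S hS
    · intro t ht
      have := hz t ht
      have e2 : ((p^k : ℕ):ℤ) = (p:ℤ)^j * (p:ℤ)^(k-j) := by
        rw [← pow_add]; push_cast; congr 1; omega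
      rw [e2] at this
      have hne : (p:ℤ)^j ≠ 0 := pow_ne_zero _ (by exact_mod_cast hp.ne_zero)
      apply (mul_dvd_mul_iff_left hne).1
      exact dcg this (by push_cast; ring) rfl
    · rintro ⟨ha, hb, hc⟩
      have hcon : p^(j+1) ∣ p^j := by
        rw [← hj]
        have key : ∀ x : ℤ, (p:ℤ) ∣ x → p^(j+1) ∣ (((p^j:ℕ):ℤ) * x).natAbs := by
          intro x hx
          rw [Int.natAbs_mul, pow_succ, Int.natAbs_natCast]
          exact mul_dvd_mul_left _ (Int.natCast_dvd.1 hx)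
        exact Nat.dvd_gcd (pow_dvd_pow _ hlt) (Nat.dvd_gcd (key _ ha) (Nat.dvd_gcd (key _ hb) (key _ hc)))
      have := (Nat.pow_dvd_pow_iff_le_right hp.one_lt).1 hcon
      omega

lemma lift_root (n : ℕ) (hn : 0 < n) : ∀ e A, e ∣ n → (e:ℤ) ∣ A^2 - 1 → ∃ γ : ℤ, ∃ e1 : ℕ,
    e1 ∣ e ∧ e ∣ 2 * e1 ∧ (n:ℤ) ∣ γ^2 - 1 ∧ (e1:ℤ) ∣ γ - A := by
  induction n using Nat.recOnPosPrimePosCoprime with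
  | zero => omega
  | one =>
    intro e A he _
    exact ⟨0, 1, one_dvd _, by rw [Nat.dvd_one.1 he]; simp, by simp, by simp⟩
  | prime_pow p k hp hk =>
    intro e A he hA
    obtain ⟨j, hj, rfl⟩ := (Nat.dvd_prime_pow hp).1 he
    have hp' : Prime (p:ℤ) := Nat.prime_iff_prime_int.mp hp
    have h1 : (p:ℤ)^j ∣ (A - 1) * (A + 1) := by
      exact dcg hA (by ring) (by push_cast; rfl)
    by_cases hj0 : j = 0
    · exact ⟨1, 1, one_dvd _, by simp [hj0], by simp, by simp⟩
    by_cases hp2 : p = 2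
    · subst hp2
      have h2 : ((2:ℕ):ℤ)^(j-1) ∣ A - 1 ∨ ((2:ℕ):ℤ)^(j-1) ∣ A + 1 := by
        by_cases hj1 : j = 1
        · left; simp [hj1]
        have heven : (2:ℤ) ∣ A - 1 := by
          have h3 : (2:ℤ) ∣ (A - 1) * (A + 1) := (dvd_pow_self (2:ℤ) hj0).trans (by exact_mod_cast h1)
          rcases Int.prime_two.dvd_mul.1 h3 with h | h <;> omega
        obtain ⟨B, hB⟩ := heven
        obtain ⟨i, rfl⟩ : ∃ i, j = i + 2 := ⟨j - 2, by omega⟩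
        have h4 : (2:ℤ)^i ∣ B * (B+1) := by
          have h5 : (4:ℤ) * 2^i ∣ 4 * (B * (B+1)) := by
            exact dcg h1 (by rw [show A = 2 * B + 1 by omega]; ring) (by push_cast; ring)
          exact (mul_dvd_mul_iff_left (by norm_num)).1 h5
        have h6 : (2:ℤ)^i ∣ B ∨ (2:ℤ)^i ∣ B + 1 := by
          rcases Int.even_or_odd B with h | h
          · left
            have : IsCoprime ((2:ℤ)^i) (B+1) := by
              apply IsCoprime.pow_left
              obtain ⟨r, hr⟩ := h
              exact ⟨-r, 1, by rw [hr]; ring⟩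
            exact this.dvd_of_dvd_mul_right h4
          · right
            have : IsCoprime ((2:ℤ)^i) B := by
              apply IsCoprime.pow_left
              obtain ⟨r, hr⟩ := h
              exact ⟨-r, 1, by rw [hr]; ring⟩
            exact this.dvd_of_dvd_mul_left h4
        rw [show i + 2 - 1 = i + 1 by omega, pow_succ']
        rcases h6 with h | h
        · left; rw [hB]; exact mul_dvd_mul_left _ h
        · right; rw [show A + 1 = 2 * (B + 1) by omega]; exact mul_dvd_mul_left _ h
      have h7 : 2^j ∣ 2 * 2^(j-1) := by rw [← pow_succ']; exact pow_dvd_pow _ (by omega)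
      rcases h2 with h | h
      · exact ⟨1, 2^(j-1), pow_dvd_pow _ (by omega), h7, by simp, by
          rw [← dvd_neg]; exact dcg h (by ring) (by push_cast; rfl)⟩
      · exact ⟨-1, 2^(j-1), pow_dvd_pow _ (by omega), h7, by simp, by
          rw [← dvd_neg]; exact dcg h (by ring) (by push_cast; rfl)⟩
    · have h2 : (p:ℤ)^j ∣ A - 1 ∨ (p:ℤ)^j ∣ A + 1 := by
        by_cases hd : (p:ℤ) ∣ A - 1
        · left
          have hnd : ¬ (p:ℤ) ∣ A + 1 := by
            intro h
            have h3 : (p:ℤ) ∣ 2 := by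
              have := dvd_sub h hd
              exact dcg this (by ring) rfl
            have h4 : p ∣ 2 := by exact_mod_cast h3
            exact hp2 ((Nat.prime_dvd_prime_iff_eq hp Nat.prime_two).1 h4)
          exact (IsCoprime.pow_left ((Prime.coprime_iff_not_dvd hp').2 hnd)).dvd_of_dvd_mul_right h1
        · right
          exact (IsCoprime.pow_left ((Prime.coprime_iff_not_dvd hp').2 hd)).dvd_of_dvd_mul_left h1
      rcases h2 with h | h
      · exact ⟨1, p^j, dvd_rfl, dvd_mul_left _ _, by simp, by
          rw [← dvd_neg]; exact dcg h (by ring) (by push_cast; rfl)⟩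
      · exact ⟨-1, p^j, dvd_rfl, dvd_mul_left _ _, by simp, by
          rw [← dvd_neg]; exact dcg h (by ring) (by push_cast; rfl)⟩
  | coprime a b ha hb hab iha ihb =>
    intro e A he hA
    have hee : e = e.gcd a * e.gcd b := by
      rw [← Nat.Coprime.gcd_mul e hab, Nat.gcd_eq_left he]
    obtain ⟨γ1, e1, h11, h12, h13, h14⟩ := iha (by omega) (e.gcd a) A (Nat.gcd_dvd_right _ _)
      ((Int.natCast_dvd_natCast.2 (Nat.gcd_dvd_left _ _)).trans hA)
    obtain ⟨γ2, e2, h21, h22, h23, h24⟩ := ihb (by omega) (e.gcd b) A (Nat.gcd_dvd_right _ _)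
      ((Int.natCast_dvd_natCast.2 (Nat.gcd_dvd_left _ _)).trans hA)
    have hab' : IsCoprime (a:ℤ) (b:ℤ) := Nat.isCoprime_iff_coprime.2 hab
    obtain ⟨u, v, huv⟩ := hab'
    have hga : (a:ℤ) ∣ (γ1 * (v * b) + γ2 * (u * a)) - γ1 :=
      ⟨u * (γ2 - γ1), by linear_combination γ1 * huv⟩
    have hgb : (b:ℤ) ∣ (γ1 * (v * b) + γ2 * (u * a)) - γ2 :=
      ⟨v * (γ1 - γ2), by linear_combination γ2 * huv⟩
    have hcc : Nat.Coprime (e.gcd a) (e.gcd b) :=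
      Nat.Coprime.of_dvd (Nat.gcd_dvd_right _ _) (Nat.gcd_dvd_right _ _) hab
    refine ⟨γ1 * (v * b) + γ2 * (u * a), e1 * e2, ?_, ?_, ?_, ?_⟩
    · rw [hee]; exact mul_dvd_mul h11 h21
    · rw [hee]
      apply hcc.mul_dvd_of_dvd_of_dvd
      · exact h12.trans ⟨e2, by ring⟩
      · exact h22.trans ⟨e1, by ring⟩
    · push_cast
      apply IsCoprime.mul_dvd (Nat.isCoprime_iff_coprime.2 hab)
      · have := dvd_add (hga.mul_right (γ1 * (v * b) + γ2 * (u * a) + γ1)) h13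
        exact dcg this (by ring) rfl
      · have := dvd_add (hgb.mul_right (γ1 * (v * b) + γ2 * (u * a) + γ2)) h23
        exact dcg this (by ring) rfl
    · push_cast
      apply IsCoprime.mul_dvd (Nat.isCoprime_iff_coprime.2 (Nat.Coprime.of_dvd h11 h21 hcc))
      · have := dvd_add ((Int.natCast_dvd_natCast.2 (h11.trans (Nat.gcd_dvd_right _ _))).trans hga) h14
        exact dcg this (by ring) rfl
      · have := dvd_add ((Int.natCast_dvd_natCast.2 (h21.trans (Nat.gcd_dvd_right _ _))).trans hgb) h24
        exact dcg this (by ring) rfl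

lemma omega_bound (ε : ℝ) (hε : 0 < ε) : ∃ C : ℝ, 0 < C ∧ ∀ n : ℕ, 0 < n →
    (4:ℝ)^(n.primeFactors.card) ≤ C * (n:ℝ)^ε := by
  obtain ⟨P, hP⟩ := exists_nat_gt ((4:ℝ)^(1/ε))
  refine ⟨4^P, by positivity, fun n hn => ?_⟩
  have h1 : (4:ℝ)^(n.primeFactors.card) ≤
      (∏ p ∈ n.primeFactors, if p < P then (4:ℝ) else 1) * ∏ p ∈ n.primeFactors, (p:ℝ)^ε := by
    rw [← Finset.prod_mul_distrib, ← Finset.prod_const]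
    apply Finset.prod_le_prod
    · intros; norm_num
    · intro p hp
      have hp1 : (1:ℝ) ≤ p := by exact_mod_cast (Nat.prime_of_mem_primeFactors hp).one_le
      split_ifs with h
      · have := Real.one_le_rpow hp1 hε.le
        linarith
      · push Not at h
        have h2 : (4:ℝ)^(1/ε) ≤ p := hP.le.trans (by exact_mod_cast h)
        have h3 := Real.rpow_le_rpow (by positivity) h2 hε.le
        rw [← Real.rpow_mul (by norm_num), one_div_mul_cancel hε.ne', Real.rpow_one] at h3
        linarith
  refine h1.trans (mul_le_mul ?_ ?_ (by positivity) (by positivity))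
  · rw [Finset.prod_ite]
    simp only [Finset.prod_const, one_pow, mul_one]
    apply pow_le_pow_right₀ (by norm_num)
    have : (n.primeFactors.filter (fun p => p < P)) ⊆ Finset.range P := by
      intro p hp; exact Finset.mem_range.2 (Finset.mem_filter.1 hp).2
    simpa using Finset.card_le_card this
  · rw [Real.finsetProd_rpow _ _ (fun _ _ => by positivity)]
    apply Real.rpow_le_rpow (by positivity) _ hε.le
    rw [← Nat.cast_prod]
    exact_mod_cast Nat.le_of_dvd hn (Nat.prod_primeFactors_dvd n)

def ZS (n : ℕ) (a b k : ℤ) : Set (ZMod n × ZMod n) :=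
  {p | IsCoprime p.1 p.2 ∧ (a : ZMod n) * p.1^2 + b * p.1 * p.2 + k * p.2^2 = 0}

def AS (n : ℕ) (a b k : ℤ) : Set (ZMod n) :=
  {t | (a : ZMod n) * t^2 + b * t + k = 0}

lemma AS_card (p k j : ℕ) (hp : p.Prime) (a b c : ℤ)
    (hj : Nat.gcd (p^k) (Nat.gcd a.natAbs (Nat.gcd b.natAbs c.natAbs)) = p^j) :
    Nat.card (AS (p^k) a b c) ≤ 2 * p^((k+j)/2) := by
  classical
  haveI : NeZero (p^k) := ⟨pow_ne_zero _ hp.ne_zero⟩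
  have h := affine p k j hp a b c hj
    ((Finset.univ.filter (fun t => t ∈ AS (p^k) a b c)).image ZMod.val) ?_ ?_
  · rw [Finset.card_image_of_injective _ (ZMod.val_injective _)] at h
    rw [Nat.card_eq_fintype_card, Fintype.card_subtype]
    exact h
  · intro t ht
    obtain ⟨x, _, rfl⟩ := Finset.mem_image.1 ht
    exact ZMod.val_lt x
  · intro t ht
    obtain ⟨x, hx, rfl⟩ := Finset.mem_image.1 ht
    have hx2 : (a : ZMod (p^k)) * x^2 + b * x + c = 0 := (Finset.mem_filter.1 hx).2
    rw [← ZMod.intCast_zmod_eq_zero_iff_dvd]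
    push_cast
    rw [ZMod.natCast_zmod_val]
    exact hx2

lemma ZS_prime (p k j : ℕ) (hp : p.Prime) (hk : 0 < k) (a b c : ℤ)
    (hj : Nat.gcd (p^k) (Nat.gcd a.natAbs (Nat.gcd b.natAbs c.natAbs)) = p^j) :
    Nat.card (ZS (p^k) a b c) ≤ 4 * (p^k).totient * p^((k+j)/2) := by
  classical
  haveI : NeZero (p^k) := ⟨pow_ne_zero _ hp.ne_zero⟩
  have hj' : Nat.gcd (p^k) (Nat.gcd c.natAbs (Nat.gcd b.natAbs a.natAbs)) = p^j := by
    rw [← hj, Nat.gcd_comm b.natAbs a.natAbs, ← Nat.gcd_assoc c.natAbs, Nat.gcd_comm c.natAbs,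
      Nat.gcd_assoc a.natAbs, Nat.gcd_comm c.natAbs]
  have h1 := AS_card p k j hp a b c hj
  have h2 := AS_card p k j hp c b a hj'
  have hunit : ∀ x y : ZMod (p^k), IsCoprime x y → IsUnit x ∨ IsUnit y := by
    intro x y hxy
    haveI := Fact.mk hp
    by_contra hcon
    push Not at hcon
    have key : ∀ z : ZMod (p^k), ¬ IsUnit z → (ZMod.castHom (dvd_pow_self p hk.ne') (ZMod p)) z = 0 := by
      intro z hz
      rw [← ZMod.natCast_zmod_val z, ZMod.isUnit_iff_coprime] at hz
      rw [← ZMod.natCast_zmod_val z, map_natCast, ZMod.natCast_eq_zero_iff]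
      by_contra hnd
      exact hz (Nat.Coprime.pow_right _ ((Nat.Prime.coprime_iff_not_dvd hp).2 hnd).symm)
    have h := hxy.map (ZMod.castHom (dvd_pow_self p hk.ne') (ZMod p))
    rw [key x hcon.1, key y hcon.2] at h
    exact not_isCoprime_zero_zero h
  let φ : ((ZMod (p^k))ˣ × AS (p^k) a b c) ⊕ ((ZMod (p^k))ˣ × AS (p^k) c b a) →
      ZMod (p^k) × ZMod (p^k) := Sum.elim (fun q => (q.2.1 * q.1, q.1)) (fun q => (q.1, q.2.1 * q.1))
  have hsub : ZS (p^k) a b c ⊆ Set.range φ := by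
    rintro ⟨x, y⟩ ⟨hxy, h⟩
    simp only at hxy h
    rcases hunit x y hxy with hu | hu
    · obtain ⟨u, rfl⟩ := hu
      refine ⟨Sum.inr (u, ⟨y * (u⁻¹ : (ZMod (p^k))ˣ), ?_⟩), ?_⟩
      · show (c : ZMod (p^k)) * _^2 + b * _ + a = 0
        have hu : (u : ZMod (p^k)) * (u⁻¹ : (ZMod (p^k))ˣ) = 1 := Units.mul_inv u
        generalize ((u⁻¹ : (ZMod (p^k))ˣ) : ZMod (p^k)) = w at *
        linear_combination w^2 * h - (a * (u * w + 1) + b * y * w) * hu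
      · simp [φ, mul_assoc]
    · obtain ⟨u, rfl⟩ := hu
      refine ⟨Sum.inl (u, ⟨x * (u⁻¹ : (ZMod (p^k))ˣ), ?_⟩), ?_⟩
      · show (a : ZMod (p^k)) * _^2 + b * _ + c = 0
        have hu : (u : ZMod (p^k)) * (u⁻¹ : (ZMod (p^k))ˣ) = 1 := Units.mul_inv u
        generalize ((u⁻¹ : (ZMod (p^k))ˣ) : ZMod (p^k)) = w at *
        linear_combination w^2 * h - (c * (u * w + 1) + b * x * w) * hu
      · simp [φ, mul_assoc]
  have h3 : Nat.card (ZS (p^k) a b c) ≤ Nat.card (Set.range φ) :=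
    Nat.card_mono (Set.toFinite _) hsub
  have h4 : Nat.card (Set.range φ) ≤ Nat.card (((ZMod (p^k))ˣ × AS (p^k) a b c) ⊕ ((ZMod (p^k))ˣ × AS (p^k) c b a)) :=
    Finite.card_range_le φ
  rw [Nat.card_sum, Nat.card_prod, Nat.card_prod, Nat.card_eq_fintype_card (α := (ZMod (p^k))ˣ),
    ZMod.card_units_eq_totient] at h4
  nlinarith [Nat.mul_le_mul_left (p^k).totient h1, Nat.mul_le_mul_left (p^k).totient h2]

lemma ZS_mul (m n : ℕ) (hm : 0 < m) (hn : 0 < n) (hmn : m.Coprime n) (a b c : ℤ) :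
    Nat.card (ZS (m * n) a b c) ≤ Nat.card (ZS m a b c) * Nat.card (ZS n a b c) := by
  haveI : NeZero m := ⟨hm.ne'⟩
  haveI : NeZero n := ⟨hn.ne'⟩
  rw [← Nat.card_prod]
  let f1 := ZMod.castHom (dvd_mul_right m n) (ZMod m)
  let f2 := ZMod.castHom (dvd_mul_left n m) (ZMod n)
  have inj : ∀ x y : ZMod (m*n), f1 x = f1 y → f2 x = f2 y → x = y := by
    intro x y h1 h2
    obtain ⟨x, rfl⟩ := ZMod.intCast_surjective x
    obtain ⟨y, rfl⟩ := ZMod.intCast_surjective y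
    rw [map_intCast, map_intCast, ZMod.intCast_eq_intCast_iff_dvd_sub] at h1 h2
    rw [ZMod.intCast_eq_intCast_iff_dvd_sub]
    push_cast
    exact IsCoprime.mul_dvd (Nat.isCoprime_iff_coprime.2 hmn) h1 h2
  have mem : ∀ (r : ℕ) (f : ZMod (m*n) →+* ZMod r) (p : ZMod (m*n) × ZMod (m*n)),
      p ∈ ZS (m*n) a b c → (f p.1, f p.2) ∈ ZS r a b c := by
    rintro r f p ⟨h1, h2⟩
    refine ⟨h1.map f, ?_⟩
    have := congrArg f h2
    simpa using this
  apply Nat.card_le_card_of_injective (fun p : ZS (m*n) a b c =>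
    ((⟨_, mem m f1 p.1 p.2⟩, ⟨_, mem n f2 p.1 p.2⟩) : ZS m a b c × ZS n a b c))
  intro p q h
  simp only [Prod.mk.injEq, Subtype.mk.injEq] at h
  exact Subtype.ext (Prod.ext (inj _ _ h.1.1 h.2.1) (inj _ _ h.1.2 h.2.2))

lemma ZS_bound (n : ℕ) (hn : 0 < n) (a b c : ℤ) : ∃ F : ℕ,
    F^2 ∣ n * Nat.gcd n (Nat.gcd a.natAbs (Nat.gcd b.natAbs c.natAbs)) ∧
    Nat.card (ZS n a b c) ≤ 4^(n.primeFactors.card) * n.totient * F := by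
  induction n using Nat.recOnPosPrimePosCoprime with
  | zero => omega
  | one =>
    refine ⟨1, by simp, ?_⟩
    have : Subsingleton (ZMod 1 × ZMod 1) := inferInstance
    simpa using Finite.card_le_one_iff_subsingleton.2 (inferInstance : Subsingleton (ZS 1 a b c))
  | prime_pow p k hp hk =>
    obtain ⟨j, hj, hj'⟩ := (Nat.dvd_prime_pow hp).1
      (Nat.gcd_dvd_left (p^k) (Nat.gcd a.natAbs (Nat.gcd b.natAbs c.natAbs)))
    refine ⟨p^((k+j)/2), ?_, ?_⟩
    · rw [hj', ← pow_mul, ← pow_add]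
      exact pow_dvd_pow _ (by omega)
    · rw [Nat.primeFactors_prime_pow hk.ne' hp, Finset.card_singleton, pow_one]
      exact ZS_prime p k j hp hk a b c hj'
  | coprime x y hx hy hxy ihx ihy =>
    obtain ⟨F1, h1, h1'⟩ := ihx (by omega)
    obtain ⟨F2, h2, h2'⟩ := ihy (by omega)
    refine ⟨F1 * F2, ?_, ?_⟩
    · rw [mul_pow, Nat.gcd_comm (x*y), Nat.Coprime.gcd_mul _ hxy, Nat.gcd_comm _ x, Nat.gcd_comm _ y]
      have := mul_dvd_mul h1 h2
      exact this.trans (dvd_of_eq (by ring))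
    · rw [hxy.primeFactors_mul, Finset.card_union_of_disjoint hxy.disjoint_primeFactors,
        Nat.totient_mul hxy, pow_add]
      calc _ ≤ _ := ZS_mul x y (by omega) (by omega) hxy a b c
        _ ≤ _ := Nat.mul_le_mul h1' h2'
        _ = _ := by ring

lemma fixed_card (c : ℕ) (hc : 0 < c) (g : SpecialLinearGroup (Fin 2) (ZMod c)) (A B C D : ℤ)
    (hA : (A : ZMod c) = g.1 0 0) (hB : (B : ZMod c) = g.1 0 1)
    (hC : (C : ZMod c) = g.1 1 0) (hD : (D : ZMod c) = g.1 1 1) :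
    c.totient * Nat.card {u : ProjLine c // act c g u = u} ≤ Nat.card (ZS c C (D - A) (-B)) := by
  haveI : NeZero c := ⟨hc.ne'⟩
  have hu : c.totient = Nat.card (ZMod c)ˣ := by
    rw [Nat.card_eq_fintype_card, ZMod.card_units_eq_totient]
  rw [hu, ← Nat.card_prod]
  have hex : ∀ u : ProjLine c, ∃ p : PrimPair c, Quotient.mk (projSetoid c) p = u :=
    fun u => Quotient.exists_rep u
  choose r hr using hex
  have mem : ∀ (α : (ZMod c)ˣ) (u : ProjLine c), act c g u = u →
      ((α : ZMod c) * (r u).1.1, (α : ZMod c) * (r u).1.2) ∈ ZS c C (D - A) (-B) := by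
    intro α u hfix
    have h1 : (projSetoid c).r (smulPair c g (r u)) (r u) := by
      have h : act c g (Quotient.mk (projSetoid c) (r u)) = Quotient.mk (projSetoid c) (r u) := by
        rw [hr]; exact hfix
      exact Quotient.exact h
    obtain ⟨β, hb1, hb2⟩ := h1
    obtain ⟨s, t, hst⟩ := (r u).2
    have hinv : ((α⁻¹ : (ZMod c)ˣ) : ZMod c) * α = 1 := Units.inv_mul α
    refine ⟨⟨s * (α⁻¹ : (ZMod c)ˣ), t * (α⁻¹ : (ZMod c)ˣ), ?_⟩, ?_⟩
    · simp only
      linear_combination hst + (s * (r u).1.1 + t * (r u).1.2) * hinv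
    · push_cast
      rw [hA, hB, hC, hD]
      have hbinv : ((β⁻¹ : (ZMod c)ˣ) : ZMod c) * β = 1 := Units.inv_mul β
      change (β : ZMod c) * (g.1 0 0 * (r u).1.1 + g.1 0 1 * (r u).1.2) = (r u).1.1 at hb1
      change (β : ZMod c) * (g.1 1 0 * (r u).1.1 + g.1 1 1 * (r u).1.2) = (r u).1.2 at hb2
      generalize ((β⁻¹ : (ZMod c)ˣ) : ZMod c) = w at *
      generalize (r u).1.1 = x at *
      generalize (r u).1.2 = y at *
      have h0 : (g.1 1 0 * x + g.1 1 1 * y) * x - (g.1 0 0 * x + g.1 0 1 * y) * y = 0 := by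
        linear_combination w * (hb2 * x - hb1 * y) - ((g.1 1 0 * x + g.1 1 1 * y) * x - (g.1 0 0 * x + g.1 0 1 * y) * y) * hbinv
      linear_combination (α : ZMod c)^2 * h0
  haveI : Finite (ZS c C (D - A) (-B)) := inferInstance
  apply Nat.card_le_card_of_injective
    (fun q : (ZMod c)ˣ × {u : ProjLine c // act c g u = u} =>
      (⟨_, mem q.1 q.2.1 q.2.2⟩ : ZS c C (D - A) (-B)))
  rintro ⟨α, u, hu⟩ ⟨β, v, hv⟩ h
  simp only [Subtype.mk.injEq, Prod.mk.injEq] at h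
  obtain ⟨h1, h2⟩ := h
  have huv : u = v := by
    rw [← hr u, ← hr v]
    apply Quotient.sound
    refine ⟨β⁻¹ * α, ?_, ?_⟩
    · rw [Units.val_mul, mul_assoc, h1, ← mul_assoc, Units.inv_mul, one_mul]
    · rw [Units.val_mul, mul_assoc, h2, ← mul_assoc, Units.inv_mul, one_mul]
  subst huv
  obtain ⟨s, t, hst⟩ := (r u).2
  have : α = β := by
    apply Units.ext
    linear_combination s * h1 + t * h2 - ((α : ZMod c) - β) * hst
  rw [this]

lemma coset_iff (c : ℕ) (e : ℕ) (hec : e ∣ c) (g : SpecialLinearGroup (Fin 2) (ZMod c))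
    (A B C D : ℤ)
    (hA : (A : ZMod c) = g.1 0 0) (hB : (B : ZMod c) = g.1 0 1)
    (hC : (C : ZMod c) = g.1 1 0) (hD : (D : ZMod c) = g.1 1 1) :
    InScalarCoset c e hec g ↔ ∃ γ : ℤ, (c : ℤ) ∣ γ^2 - 1 ∧ (e:ℤ) ∣ A - γ ∧ (e:ℤ) ∣ B ∧
      (e:ℤ) ∣ C ∧ (e:ℤ) ∣ D - γ := by
  have hsq : ∀ γ : ℤ, ((γ : ZMod c)^2 = 1 ↔ (c : ℤ) ∣ γ^2 - 1) := by
    intro γ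
    rw [← ZMod.intCast_zmod_eq_zero_iff_dvd]
    push_cast
    rw [sub_eq_zero]
  have hm : ∀ γ : ℤ, ((SpecialLinearGroup.map (ZMod.castHom hec (ZMod e)) g).1
      = (ZMod.castHom hec (ZMod e) (γ : ZMod c)) • (1 : Matrix (Fin 2) (Fin 2) (ZMod e))) ↔
      ((e:ℤ) ∣ A - γ ∧ (e:ℤ) ∣ B ∧ (e:ℤ) ∣ C ∧ (e:ℤ) ∣ D - γ) := by
    intro γ
    simp only [← ZMod.intCast_zmod_eq_zero_iff_dvd]
    push_cast
    rw [sub_eq_zero, sub_eq_zero]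
    have e1 : ∀ i j, (SpecialLinearGroup.map (ZMod.castHom hec (ZMod e)) g).1 i j
      = ZMod.castHom hec (ZMod e) (g.1 i j) := fun i j => rfl
    constructor
    · intro h
      have h' : ∀ i j, ZMod.castHom hec (ZMod e) (g.1 i j) =
        ((ZMod.castHom hec (ZMod e) (γ : ZMod c)) • (1 : Matrix (Fin 2) (Fin 2) (ZMod e))) i j := by
        intro i j; rw [← e1, h]
      have h00 := h' 0 0
      have h01 := h' 0 1
      have h10 := h' 1 0
      have h11 := h' 1 1
      rw [← hA] at h00
      rw [← hB] at h01
      rw [← hC] at h10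
      rw [← hD] at h11
      rw [map_intCast] at h00 h01 h10 h11
      simp at h00 h01 h10 h11
      exact ⟨h00, h01, h10, h11⟩
    · rintro ⟨h1, h2, h3, h4⟩
      ext i j
      rw [e1]
      fin_cases i <;> fin_cases j
      · simp [← hA, h1]
      · simp [← hB, h2]
      · simp [← hC, h3]
      · simp [← hD, h4]
  constructor
  · rintro ⟨γ, h1, h2⟩
    obtain ⟨γ, rfl⟩ := ZMod.intCast_surjective γ
    exact ⟨γ, (hsq γ).1 h1, (hm γ).1 h2⟩
  · rintro ⟨γ, h1, h2⟩
    exact ⟨γ, (hsq γ).2 h1, (hm γ).2 h2⟩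

/-- Let `d ∣ c` be the largest divisor of `c` with
`g ∈ {γI : γ² = 1}·Γ_c(d)`, and let `f` be the largest integer with `f² ∣ cd`. Then
the number of fixed points of `g` on `ℙ¹(ℤ/cℤ)` is `O_ε(c^ε f)` for every `ε > 0`. -/
theorem stmt19 : ∀ ε : ℝ, 0 < ε → ∃ C : ℝ, 0 < C ∧
    ∀ (c d f : ℕ) (hc : 0 < c) (hdc : d ∣ c)
      (g : SpecialLinearGroup (Fin 2) (ZMod c)),
      InScalarCoset c d hdc g →
      (∀ (e : ℕ) (hec : e ∣ c), InScalarCoset c e hec g → e ≤ d) →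
      0 < f → f ^ 2 ∣ c * d → (∀ f' : ℕ, f' ^ 2 ∣ c * d → f' ≤ f) →
      (Nat.card {u : ProjLine c // act c g u = u} : ℝ) ≤ C * (c : ℝ) ^ ε * (f : ℝ) := by
  intro ε hε
  obtain ⟨K, hK, hbound⟩ := omega_bound ε hε
  refine ⟨2 * K, by positivity, ?_⟩
  intro c d f hc hdc g hg hmax hf hfd hfmax
  obtain ⟨A, hA⟩ := ZMod.intCast_surjective (g.1 0 0)
  obtain ⟨B, hB⟩ := ZMod.intCast_surjective (g.1 0 1)
  obtain ⟨C, hC⟩ := ZMod.intCast_surjective (g.1 1 0)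
  obtain ⟨D, hD⟩ := ZMod.intCast_surjective (g.1 1 1)
  obtain ⟨F, hF, hcard⟩ := ZS_bound c hc C (D - A) (-B)
  have hfix := fixed_card c hc g A B C D hA hB hC hD
  set e := Nat.gcd c (Nat.gcd C.natAbs (Nat.gcd (D - A).natAbs (-B).natAbs)) with he
  have hec : e ∣ c := Nat.gcd_dvd_left _ _
  have hrest : e ∣ (Nat.gcd C.natAbs (Nat.gcd (D - A).natAbs (-B).natAbs)) := Nat.gcd_dvd_right _ _
  have heC : (e:ℤ) ∣ C := Int.natCast_dvd.2 (hrest.trans (Nat.gcd_dvd_left _ _))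
  have heDA : (e:ℤ) ∣ D - A :=
    Int.natCast_dvd.2 (hrest.trans ((Nat.gcd_dvd_right _ _).trans (Nat.gcd_dvd_left _ _)))
  have heB : (e:ℤ) ∣ B := by
    rw [← dvd_neg]
    exact Int.natCast_dvd.2 (hrest.trans ((Nat.gcd_dvd_right _ _).trans (Nat.gcd_dvd_right _ _)))
  have hdet : (c:ℤ) ∣ A * D - B * C - 1 := by
    rw [← ZMod.intCast_zmod_eq_zero_iff_dvd]
    push_cast
    rw [hA, hB, hC, hD, sub_eq_zero]
    have h2 := g.2
    rwa [Matrix.det_fin_two] at h2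
  have hAsq : (e:ℤ) ∣ A^2 - 1 := by
    have h1 := (Int.natCast_dvd_natCast.2 hec).trans hdet
    exact dcg (dvd_add (dvd_sub h1 (heDA.mul_left A)) (heB.mul_right C)) (by ring) rfl
  obtain ⟨γ, e1, h1e, h2e, hγ, hγA⟩ := lift_root c hc e A hec hAsq
  have h1e' : (e1:ℤ) ∣ (e:ℤ) := Int.natCast_dvd_natCast.2 h1e
  have he1d : e1 ≤ d := by
    refine hmax e1 (h1e.trans hec) ((coset_iff c e1 _ g A B C D hA hB hC hD).2 ⟨γ, hγ, ?_, h1e'.trans heB,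
      h1e'.trans heC, ?_⟩)
    · rw [← dvd_neg]; exact dcg hγA (by ring) rfl
    · exact dcg (dvd_sub (h1e'.trans heDA) hγA) (by ring) rfl
  have hde : d ∣ e := by
    obtain ⟨δ, _, k1, k2, k3, k4⟩ := (coset_iff c d hdc g A B C D hA hB hC hD).1 hg
    refine Nat.dvd_gcd hdc (Nat.dvd_gcd (Int.natCast_dvd.1 k3) (Nat.dvd_gcd (Int.natCast_dvd.1 ?_)
      (Int.natCast_dvd.1 ((dvd_neg).2 k2))))
    exact dcg (dvd_sub k4 k1) (by ring) rfl
  have he0 : 0 < e := Nat.pos_of_dvd_of_pos hec hc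
  have he2d : e ∣ 2 * d := by
    have hd0 : 0 < d := Nat.pos_of_dvd_of_pos hde he0
    have hle : e ≤ 2 * e1 := by
      apply Nat.le_of_dvd _ h2e
      have := Nat.pos_of_dvd_of_pos h1e he0
      omega
    obtain ⟨t, ht⟩ := hde
    have ht2 : t ≤ 2 := by
      by_contra hcon
      push Not at hcon
      have : d * 3 ≤ d * t := Nat.mul_le_mul_left d hcon
      omega
    rw [ht]
    interval_cases t
    · omega
    · exact ⟨2, by ring⟩
    · exact ⟨1, by ring⟩
  have hF2 : F^2 ∣ 2 * (c * d) := hF.trans ((mul_dvd_mul_left c he2d).trans ⟨1, by ring⟩)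
  have hFf : F ≤ 2 * f := by
    rcases Nat.even_or_odd F with ⟨r, hr⟩ | hodd
    · have h4 : 2 * (2 * r^2) ∣ 2 * (c * d) := by
        have h5 : F^2 = 2 * (2 * r^2) := by rw [hr]; ring
        rwa [h5] at hF2
      have h6 : 2 * r^2 ∣ c * d := (Nat.mul_dvd_mul_iff_left (by norm_num)).1 h4
      have := hfmax r ((dvd_mul_left _ _).trans h6)
      omega
    · have hco : Nat.Coprime (F^2) 2 := (Nat.coprime_two_right.2 hodd).pow_left 2
      have := hfmax F (hco.dvd_of_dvd_mul_left hF2)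
      omega
  have hφ : 0 < c.totient := Nat.totient_pos.2 hc
  have hfin : Nat.card {u : ProjLine c // act c g u = u} ≤ 4^(c.primeFactors.card) * (2 * f) := by
    apply Nat.le_of_mul_le_mul_left _ hφ
    calc _ ≤ _ := hfix
      _ ≤ _ := hcard
      _ ≤ 4^(c.primeFactors.card) * c.totient * (2 * f) := Nat.mul_le_mul_left _ hFf
      _ = _ := by ring
  have hfin' : (Nat.card {u : ProjLine c // act c g u = u} : ℝ) ≤
      4^(c.primeFactors.card) * (2 * f) := by exact_mod_cast hfin
  calc _ ≤ _ := hfin'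
    _ ≤ (K * (c:ℝ)^ε) * (2 * f) := mul_le_mul_of_nonneg_right (hbound c hc) (by positivity)
    _ = _ := by ring

end Stmt19
end
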